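/- arXiv:1406.2754 — 6 statements merged into one kernel-verified Lean document; each statement's English description precedes it below -/
import Mathlib

section
/- If a distribution F on [0,∞) belongs to the class 𝒪𝒮 (generalized subexponential) and F is heavy-tailed, then F is strongly heavy-tailed, i.e. lim_{x→∞} e^{λx} F̄(x) = ∞ for every λ > 0. Equivalently, 𝒪𝒮 ∩ 𝒦 ⊆ 𝒟𝒦ᶜ. -/
open MeasureTheory Filter Set Topology

noncomputable section

/-- The (real-valued) tail function of a measure `F` on `ℝ`: `F̄(x) = F((x,∞))`. -/
def tail (F : Measure ℝ) (x : ℝ) : ℝ := (F (Set.Ioi x)).toReal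

/-- A distribution: a Borel probability measure on `[0,∞)` with unbounded support. -/
def IsDistribution (F : Measure ℝ) : Prop :=
  IsProbabilityMeasure F ∧ F (Set.Iio 0) = 0 ∧ ∀ x : ℝ, 0 < F (Set.Ioi x)

/-- The convolution `F*2` of `F` with itself: the law of `X₁ + X₂` for independent `X₁, X₂ ∼ F`. -/
def conv2 (F : Measure ℝ) : Measure ℝ := (F.prod F).map fun p => p.1 + p.2

/-- Heavy-tailed (class 𝒦): all exponential moments are infinite. -/
def HeavyTailed (F : Measure ℝ) : Prop :=
  ∀ a : ℝ, 0 < a → ∫⁻ y, ENNReal.ofReal (Real.exp (a * y)) ∂F = ⊤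

/-- Class 𝒪𝒮 (generalized subexponential): `limsup F̄*²(x)/F̄(x) < ∞`. -/
def MemOS (F : Measure ℝ) : Prop :=
  Filter.atTop.limsup (fun x : ℝ => conv2 F (Set.Ioi x) / F (Set.Ioi x)) < ⊤

/-- Class 𝒟𝒦ᶜ (strongly heavy-tailed): `e^{λx} F̄(x) → ∞` for every `λ > 0`. -/
def StronglyHeavyTailed (F : Measure ℝ) : Prop :=
  ∀ l : ℝ, 0 < l →
    Filter.Tendsto (fun x : ℝ => Real.exp (l * x) * tail F x) Filter.atTop Filter.atTop

/-- Class 𝒟𝒦₁: `x^δ F̄(x) → ∞` for some `δ > 0`. -/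
def MemDK1 (F : Measure ℝ) : Prop :=
  ∃ δ : ℝ, 0 < δ ∧
    Filter.Tendsto (fun x : ℝ => x ^ δ * tail F x) Filter.atTop Filter.atTop

/-- Class ℒ (long-tailed): `F̄(x-t)/F̄(x) → 1` for every `t > 0`. -/
def MemL (F : Measure ℝ) : Prop :=
  ∀ t : ℝ, 0 < t →
    Filter.Tendsto (fun x : ℝ => tail F (x - t) / tail F x) Filter.atTop (nhds 1)

/-- Class 𝒟 (dominatedly varying): `limsup F̄(x/2)/F̄(x) < ∞`. -/
def MemD (F : Measure ℝ) : Prop :=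
  Filter.atTop.limsup (fun x : ℝ => F (Set.Ioi (x / 2)) / F (Set.Ioi x)) < ⊤

/-- Class 𝒪ℒ (generalized long-tailed): `limsup F̄(x-t)/F̄(x) < ∞` for every `t > 0`. -/
def MemOL (F : Measure ℝ) : Prop :=
  ∀ t : ℝ, 0 < t →
    Filter.atTop.limsup (fun x : ℝ => F (Set.Ioi (x - t)) / F (Set.Ioi x)) < ⊤

/-- Class 𝒮 (subexponential): `F̄*²(x)/F̄(x) → 2`. -/
def MemS (F : Measure ℝ) : Prop :=
  Filter.Tendsto (fun x : ℝ => (conv2 F (Set.Ioi x)).toReal / tail F x)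
    Filter.atTop (nhds 2)

/-- Class 𝒥 (principle of a single big jump, for `n = 2`):
`lim_{K→∞} liminf_{x→∞} P(min(X₁,X₂) ≤ K | X₁+X₂ > x) = 1` for independent `X₁, X₂ ∼ F`. -/
def MemJ (F : Measure ℝ) : Prop :=
  Filter.Tendsto (fun K : ℝ => Filter.atTop.liminf (fun x : ℝ =>
      ((F.prod F) {p : ℝ × ℝ | min p.1 p.2 ≤ K ∧ x < p.1 + p.2}).toReal /
      ((F.prod F) {p : ℝ × ℝ | x < p.1 + p.2}).toReal))
    Filter.atTop (nhds 1)

/-- Weak tail equivalence: `0 < liminf F̄(x)/Ḡ(x) ≤ limsup F̄(x)/Ḡ(x) < ∞`. -/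
def WeakTailEquiv (F G : Measure ℝ) : Prop :=
  0 < Filter.atTop.liminf (fun x : ℝ => F (Set.Ioi x) / G (Set.Ioi x)) ∧
  Filter.atTop.limsup (fun x : ℝ => F (Set.Ioi x) / G (Set.Ioi x)) < ⊤

lemma tail_antitone (F : Measure ℝ) [IsProbabilityMeasure F] : Antitone (tail F) := fun _ _ h =>
  ENNReal.toReal_mono (measure_ne_top _ _) (measure_mono (Ioi_subset_Ioi h))

lemma tail_le_one (F : Measure ℝ) [IsProbabilityMeasure F] (x : ℝ) : tail F x ≤ 1 :=
  ENNReal.toReal_le_of_le_ofReal zero_le_one (by simpa using prob_le_one)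

lemma IsDistribution.tail_pos {F : Measure ℝ} (hF : IsDistribution F) (x : ℝ) : 0 < tail F x :=
  have := hF.1
  ENNReal.toReal_pos (hF.2.2 x).ne' (measure_ne_top _ _)

lemma measure_Ioi_mul_le_conv2_Ioi (F : Measure ℝ) [IsProbabilityMeasure F] (x y : ℝ) :
    F (Ioi x) * F (Ioi y) ≤ conv2 F (Ioi (x + y)) := by
  rw [conv2, Measure.map_apply (by fun_prop) measurableSet_Ioi, ← Measure.prod_prod]
  refine measure_mono fun p hp => ?_
  obtain ⟨h1, h2⟩ := hp
  simp only [mem_Ioi, mem_preimage] at *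
  linarith

/-- The tail of a generalized subexponential distribution is supermultiplicative up to a
constant. -/
lemma MemOS.exists_tail_mul_tail_le {F : Measure ℝ} (hF : IsDistribution F) (hOS : MemOS F) :
    ∃ C : ℝ, 1 ≤ C ∧ ∀ x y : ℝ, tail F x * tail F y ≤ C * tail F (x + y) := by
  have := hF.1
  obtain ⟨c, hc, hctop⟩ := exists_between hOS
  obtain ⟨x₀, hx₀⟩ := eventually_atTop.1 (eventually_lt_of_limsup_lt hc)
  have hp := hF.tail_pos
  refine ⟨max c.toReal (1 / tail F x₀), le_max_of_le_right ?_, fun x y => ?_⟩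
  · rw [le_div_iff₀ (hp x₀)]
    simpa using tail_le_one F x₀
  rcases le_total x₀ (x + y) with h | h
  · have h1 : F (Ioi x) * F (Ioi y) ≤ c * F (Ioi (x + y)) :=
      (measure_Ioi_mul_le_conv2_Ioi F x y).trans
        ((ENNReal.div_le_iff (hF.2.2 _).ne' (measure_ne_top _ _)).1 (hx₀ _ h).le)
    have h2 := ENNReal.toReal_mono (ENNReal.mul_ne_top hctop.ne (measure_ne_top _ _)) h1
    rw [ENNReal.toReal_mul, ENNReal.toReal_mul] at h2
    exact h2.trans (mul_le_mul_of_nonneg_right (le_max_left _ _) (hp _).le)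
  · calc tail F x * tail F y ≤ 1 :=
          mul_le_one₀ (tail_le_one F x) (hp y).le (tail_le_one F y)
      _ = 1 / tail F x₀ * tail F x₀ := (div_mul_cancel₀ _ (hp x₀).ne').symm
      _ ≤ _ := mul_le_mul (le_max_right _ _) (tail_antitone F h) (hp _).le
          (le_max_of_le_left ENNReal.toReal_nonneg)

/-- An exponentially decaying tail rules out heavy-tailedness. -/
lemma not_heavyTailed_of_tail_le {F : Measure ℝ} (hF : IsDistribution F) {a C : ℝ} (ha : 0 < a)
    (h : ∀ y, tail F y ≤ C * Real.exp (-(a * y))) : ¬ HeavyTailed F := by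
  have := hF.1
  intro hK
  refine (hK (a / 2) (half_pos ha)).not_lt ?_
  have hC : 0 ≤ C := by simpa using (hF.tail_pos 0).le.trans (h 0)
  have hnn : ∀ᵐ y ∂F, 0 ≤ y := by
    rw [ae_iff]
    simpa [Iio] using hF.2.1
  have hsum : Summable fun n : ℕ =>
      C * Real.exp (3 / 2 * a) * Real.exp (-(a / 2)) ^ n :=
    (summable_geometric_of_lt_one (Real.exp_pos _).le
      (Real.exp_lt_one_iff.2 (by linarith))).mul_left _
  calc ∫⁻ y, ENNReal.ofReal (Real.exp (a / 2 * y)) ∂F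
      ≤ ∫⁻ y, ∑' n : ℕ, (Ioi ((n : ℝ) - 1)).indicator
          (fun _ => ENNReal.ofReal (Real.exp (a / 2 * (n + 1)))) y ∂F := by
        refine lintegral_mono_ae (hnn.mono fun y hy => ?_)
        refine le_trans ?_ (ENNReal.le_tsum ⌊y⌋₊)
        have h1 := Nat.floor_le hy
        have h2 := Nat.lt_floor_add_one y
        rw [indicator_of_mem (by rw [mem_Ioi]; linarith)]
        gcongr
    _ = ∑' n : ℕ, ENNReal.ofReal (Real.exp (a / 2 * (n + 1))) * F (Ioi ((n : ℝ) - 1)) := by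
        rw [lintegral_tsum fun n => (measurable_const.indicator measurableSet_Ioi).aemeasurable]
        simp_rw [lintegral_indicator_const measurableSet_Ioi]
    _ ≤ ∑' n : ℕ, ENNReal.ofReal (C * Real.exp (3 / 2 * a) * Real.exp (-(a / 2)) ^ n) := by
        refine ENNReal.tsum_le_tsum fun n => ?_
        rw [← ENNReal.ofReal_toReal (measure_ne_top F _),
          ← ENNReal.ofReal_mul (Real.exp_pos _).le]
        refine ENNReal.ofReal_le_ofReal ?_
        calc Real.exp (a / 2 * (n + 1)) * tail F (n - 1)
            ≤ Real.exp (a / 2 * (n + 1)) * (C * Real.exp (-(a * (n - 1)))) := by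
              gcongr
              exact h _
          _ = C * (Real.exp (a / 2 * (n + 1)) * Real.exp (-(a * (n - 1)))) := by ring
          _ = C * (Real.exp (3 / 2 * a) * Real.exp (n * -(a / 2))) := by
              rw [← Real.exp_add, ← Real.exp_add]
              ring_nf
          _ = _ := by rw [Real.exp_nat_mul, mul_assoc]
    _ < ⊤ := by
        rw [← ENNReal.ofReal_tsum_of_nonneg (fun n => by positivity) hsum]
        exact ENNReal.ofReal_lt_top

/-- `𝒪𝒮 ∩ 𝒦 ⊆ 𝒟𝒦ᶜ`: every heavy-tailed generalized subexponential
distribution is strongly heavy-tailed. -/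
theorem os_inter_heavy_subset_stronglyHeavy (F : Measure ℝ)
    (hF : IsDistribution F) (hOS : MemOS F) (hK : HeavyTailed F) :
    StronglyHeavyTailed F := by
  have := hF.1
  intro l hl
  obtain ⟨C, hC1, hC⟩ := hOS.exists_tail_mul_tail_le hF
  have hC0 : 0 < C := by linarith
  obtain ⟨a, ha, rfl⟩ : ∃ a, 0 < a ∧ l = 2 * a := ⟨l / 2, by linarith, by ring⟩
  obtain ⟨y, hy⟩ : ∃ y, C * Real.exp (-(a * y)) < tail F y := by
    by_contra! h
    exact not_heavyTailed_of_tail_le hF ha h hK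
  have hy0 : 0 < y := by
    by_contra! h
    have h1 : 1 ≤ Real.exp (-(a * y)) := Real.one_le_exp (by nlinarith)
    nlinarith [tail_le_one F y]
  have hmul : ∀ n : ℕ, C * Real.exp (-(a * ((n + 1 : ℕ) * y))) ≤ tail F ((n + 1 : ℕ) * y) := by
    intro n
    induction n with
    | zero => simpa using hy.le
    | succ n ih =>
      refine le_of_mul_le_mul_left ?_ hC0
      calc C * (C * Real.exp (-(a * ((n + 1 + 1 : ℕ) * y))))
          = (C * Real.exp (-(a * ((n + 1 : ℕ) * y)))) * (C * Real.exp (-(a * y))) := by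
            rw [mul_mul_mul_comm, ← Real.exp_add, ← mul_assoc]
            push_cast
            ring_nf
        _ ≤ tail F ((n + 1 : ℕ) * y) * tail F y :=
            mul_le_mul ih hy.le (by positivity) (hF.tail_pos _).le
        _ ≤ C * tail F ((n + 1 + 1 : ℕ) * y) := by
            convert hC _ _ using 3
            push_cast
            ring
  have hlow : ∀ x : ℝ, 0 ≤ x →
      C * Real.exp (-(a * y)) * Real.exp (a * x) ≤ Real.exp (2 * a * x) * tail F x := by
    intro x hx
    have h1 : (⌊x / y⌋₊ : ℝ) * y ≤ x := (le_div_iff₀ hy0).1 (Nat.floor_le (by positivity))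
    have h2 : x ≤ ((⌊x / y⌋₊ + 1 : ℕ) : ℝ) * y := by
      rw [← div_le_iff₀ hy0]
      push_cast
      exact (Nat.lt_floor_add_one _).le
    have h3 : C * Real.exp (-(a * (x + y))) ≤ tail F x := by
      refine le_trans ?_ ((hmul ⌊x / y⌋₊).trans (tail_antitone F h2))
      gcongr
      push_cast
      linarith
    calc C * Real.exp (-(a * y)) * Real.exp (a * x)
        = Real.exp (2 * a * x) * (C * Real.exp (-(a * (x + y)))) := by
          rw [mul_left_comm, mul_assoc, ← Real.exp_add, ← Real.exp_add]
          ring_nf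
      _ ≤ _ := by gcongr
  refine tendsto_atTop_mono' _ ((eventually_ge_atTop 0).mono hlow) ?_
  exact (Real.tendsto_exp_atTop.comp (tendsto_id.const_mul_atTop ha)).const_mul_atTop
    (by positivity)
end
end

section
/- If a distribution F on [0,∞) belongs to 𝒪𝒮, then there exist a constant C ∈ (0,∞) and y₀ > 0 such that for every positive integer m and every y > 0 with 2^{1−m} y ≥ y₀, one has F̄(2^{−m} y) ≤ C · (F̄(y))^{2^{−m}}. -/
open MeasureTheory Filter Set Topology

noncomputable section

theorem tail_half_sq_le (F : Measure ℝ) (hF : IsDistribution F) (hOS : MemOS F) :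
    ∃ K : ℝ, 1 ≤ K ∧ ∃ x₀ : ℝ, 0 < x₀ ∧ ∀ x, x₀ ≤ x → tail F (x / 2) ^ 2 ≤ K * tail F x := by
  obtain ⟨hprob, -, hpos⟩ := hF
  obtain ⟨L, hL, hLtop⟩ := exists_between hOS
  obtain ⟨a, ha⟩ := eventually_atTop.1 (eventually_lt_of_limsup_lt hL)
  refine ⟨max 1 L.toReal, le_max_left _ _, max a 1, by positivity, fun x hx => ?_⟩
  have hconv : F (Ioi (x / 2)) * F (Ioi (x / 2)) ≤ conv2 F (Ioi x) := by
    rw [conv2, Measure.map_apply (by fun_prop) measurableSet_Ioi, ← Measure.prod_prod]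
    refine measure_mono fun p hp => ?_
    have h1 : x / 2 < p.1 := hp.1
    have h2 : x / 2 < p.2 := hp.2
    change x < p.1 + p.2
    linarith
  have hratio : conv2 F (Ioi x) ≤ L * F (Ioi x) :=
    (ENNReal.div_le_iff (hpos x).ne' (measure_ne_top F _)).1 (ha x (le_of_max_le_left hx)).le
  have hreal := ENNReal.toReal_mono (ENNReal.mul_ne_top hLtop.ne (measure_ne_top F _))
    (hconv.trans hratio)
  rw [ENNReal.toReal_mul, ENNReal.toReal_mul] at hreal
  rw [sq]
  exact hreal.trans (mul_le_mul_of_nonneg_right (le_max_right _ _) ENNReal.toReal_nonneg)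

theorem pow_two_pow_le_of_sq_half_le {g : ℝ → ℝ} (hg : ∀ x, 0 ≤ g x) {x₀ : ℝ} (hx₀ : 0 < x₀)
    (h : ∀ x, x₀ ≤ x → g (x / 2) ^ 2 ≤ g x) (m : ℕ) (z : ℝ) (hz : x₀ ≤ 2 * z) :
    g z ^ 2 ^ m ≤ g (2 ^ m * z) := by
  induction m with
  | zero => simp
  | succ n ih =>
    have hz0 : 0 < z := by linarith
    have hge : 2 * z ≤ 2 ^ (n + 1) * z := by
      rw [pow_succ]
      nlinarith [one_le_pow₀ (n := n) (one_le_two (α := ℝ))]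
    calc g z ^ 2 ^ (n + 1) = (g z ^ 2 ^ n) ^ 2 := by rw [pow_succ, pow_mul]
      _ ≤ g (2 ^ n * z) ^ 2 := pow_le_pow_left₀ (pow_nonneg (hg z) _) ih 2
      _ = g (2 ^ (n + 1) * z / 2) ^ 2 := by congr 2; ring
      _ ≤ g (2 ^ (n + 1) * z) := h _ (hz.trans hge)

/-- if `F ∈ 𝒪𝒮` then there are `C ∈ (0,∞)` and `y₀ > 0` such that for every
positive integer `m` and every `y > 0` with `2^{1-m} y ≥ y₀` one has
`F̄(2^{-m} y) ≤ C (F̄(y))^{2^{-m}}`. -/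
theorem os_iteration_bound (F : Measure ℝ)
    (hF : IsDistribution F) (hOS : MemOS F) :
    ∃ C : ℝ, 0 < C ∧ ∃ y₀ : ℝ, 0 < y₀ ∧
      ∀ m : ℕ, 1 ≤ m → ∀ y : ℝ, 0 < y → y₀ ≤ (2 : ℝ) ^ ((1 : ℝ) - (m : ℝ)) * y →
        tail F ((2 : ℝ) ^ (-(m : ℝ)) * y) ≤ C * tail F y ^ ((2 : ℝ) ^ (-(m : ℝ))) := by
  obtain ⟨K, hK, x₀, hx₀, h⟩ := tail_half_sq_le F hF hOS
  have hK0 : 0 < K := by linarith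
  have htail (x : ℝ) : 0 ≤ tail F x := ENNReal.toReal_nonneg
  refine ⟨K, hK0, x₀, hx₀, fun m _ y _ hy => ?_⟩
  have hexp : (2 : ℝ) ^ (-(m : ℝ)) = ((2 ^ m : ℕ) : ℝ)⁻¹ := by
    rw [Real.rpow_neg zero_le_two, Real.rpow_natCast]
    push_cast
    rfl
  set z := (2 : ℝ) ^ (-(m : ℝ)) * y with hz
  have hzx : x₀ ≤ 2 * z := by
    rwa [sub_eq_add_neg, Real.rpow_add two_pos, Real.rpow_one, mul_assoc] at hy
  have hyz : 2 ^ m * z = y := by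
    rw [hz, hexp]
    push_cast
    field_simp
  have hpow := pow_two_pow_le_of_sq_half_le (g := fun x => tail F x / K)
    (fun x => div_nonneg (htail x) hK0.le) hx₀
    (fun x hx => by
      rw [div_pow, div_le_div_iff₀ (by positivity) hK0]
      nlinarith [h x hx]) m z hzx
  simp only [hyz] at hpow
  have hroot : tail F z / K ≤ tail F y ^ ((2 : ℝ) ^ (-(m : ℝ))) := by
    rw [hexp]
    calc tail F z / K = ((tail F z / K) ^ 2 ^ m) ^ (((2 ^ m : ℕ) : ℝ)⁻¹) :=
          (Real.pow_rpow_inv_natCast (div_nonneg (htail z) hK0.le) (by positivity)).symm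
      _ ≤ tail F y ^ (((2 ^ m : ℕ) : ℝ)⁻¹) :=
          Real.rpow_le_rpow (pow_nonneg (div_nonneg (htail z) hK0.le) _)
            (hpow.trans (div_le_self (htail y) hK)) (by positivity)
  rwa [div_le_iff₀' hK0] at hroot
end
end

section
/- Let x₀ = 0 and x_n = Σ_{k=1}^n k^{k−2} for n ≥ 1, and let F be the distribution on [0,∞) with tail F̄(x) = n^{−n} for x ∈ [x_{n−1}, x_n), n ≥ 1. Then F̄(x_n − 1)/F̄(x_n) = (n+1)^{n+1}/n^n ≥ n+1 for all sufficiently large n, so limsup_{x→∞} F̄(x−1)/F̄(x) = ∞ and consequently F ∉ 𝒪ℒ. -/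
open MeasureTheory Filter Set Topology

noncomputable section

theorem one_le_succ_rpow_sub_one (k : ℕ) :
    (1 : ℝ) ≤ ((k : ℝ) + 1) ^ (((k : ℝ) + 1) - 2) := by
  rcases Nat.eq_zero_or_pos k with rfl | hk
  · simp
  · have hk' : (1 : ℝ) ≤ k := by exact_mod_cast hk
    exact Real.one_le_rpow (by linarith) (by linarith)

theorem succ_le_succ_rpow_div_rpow {n : ℕ} (hn : 0 < n) :
    (n : ℝ) + 1 ≤ ((n : ℝ) + 1) ^ ((n : ℝ) + 1) / (n : ℝ) ^ (n : ℝ) := by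
  have hn' : (0 : ℝ) < n := by exact_mod_cast hn
  rw [le_div_iff₀ (by positivity), Real.rpow_add (by positivity), Real.rpow_one, mul_comm]
  gcongr
  linarith

/-- Goldie's example. With `x₀ = 0`, `x_n = ∑_{k=1}^n k^{k-2}` and
`F̄(y) = n^{-n}` on `[x_{n-1}, x_n)`, one has
`F̄(x_n - 1)/F̄(x_n) = (n+1)^{n+1}/n^n ≥ n+1` for all large `n`, hence
`limsup_{x→∞} F̄(x-1)/F̄(x) = ∞` and `F ∉ 𝒪ℒ`. -/
theorem goldie_example_not_OL (x : ℕ → ℝ)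
    (hx : ∀ n : ℕ, x n = ∑ k ∈ Finset.range n, ((k : ℝ) + 1) ^ (((k : ℝ) + 1) - 2))
    (F : Measure ℝ) (hF : IsDistribution F)
    (htail : ∀ n : ℕ, ∀ y : ℝ, x n ≤ y → y < x (n + 1) →
      F (Set.Ioi y) = ENNReal.ofReal (((n : ℝ) + 1) ^ (-((n : ℝ) + 1)))) :
    (∀ᶠ n : ℕ in Filter.atTop,
        tail F (x n - 1) / tail F (x n) = ((n : ℝ) + 1) ^ ((n : ℝ) + 1) / (n : ℝ) ^ (n : ℝ) ∧
        (n : ℝ) + 1 ≤ tail F (x n - 1) / tail F (x n)) ∧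
    Filter.atTop.limsup (fun y : ℝ => F (Set.Ioi (y - 1)) / F (Set.Ioi y)) = ⊤ ∧
    ¬ MemOL F := by
  have hstep : ∀ n, x n + 1 ≤ x (n + 1) := fun n => by
    rw [hx (n + 1), Finset.sum_range_succ, ← hx n]
    linarith [one_le_succ_rpow_sub_one n]
  have hxn : ∀ n : ℕ, (n : ℝ) ≤ x n := fun n => by
    induction n with
    | zero => simp [hx]
    | succ k ih => push_cast; linarith [hstep k]
  have hxtop : Tendsto x atTop atTop := tendsto_atTop_mono hxn tendsto_natCast_atTop_atTop
  have hat : ∀ n : ℕ, F (Ioi (x n)) = ENNReal.ofReal (((n : ℝ) + 1) ^ (-((n : ℝ) + 1))) :=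
    fun n => htail n _ le_rfl (by linarith [hstep n])
  have hbefore : ∀ n : ℕ, 0 < n →
      F (Ioi (x n - 1)) = ENNReal.ofReal ((n : ℝ) ^ (-(n : ℝ))) := fun n hn => by
    obtain ⟨m, rfl⟩ := Nat.exists_eq_succ_of_ne_zero hn.ne'
    rw [htail m _ (by linarith [hstep m]) (by linarith)]
    push_cast
    rfl
  have hratio : ∀ n : ℕ, 0 < n → tail F (x n - 1) / tail F (x n) =
      ((n : ℝ) + 1) ^ ((n : ℝ) + 1) / (n : ℝ) ^ (n : ℝ) := fun n hn => by
    have hn' : (0 : ℝ) < n := by exact_mod_cast hn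
    rw [tail, tail, hat, hbefore n hn, ENNReal.toReal_ofReal (by positivity),
      ENNReal.toReal_ofReal (by positivity), Real.rpow_neg (by positivity),
      Real.rpow_neg (by positivity), inv_div_inv]
  have hlim : atTop.limsup (fun y : ℝ => F (Ioi (y - 1)) / F (Ioi y)) = ⊤ := by
    have := hF.1
    refine ENNReal.eq_top_of_forall_nnreal_le fun r => le_limsup_of_frequently_le ?_
    refine hxtop.frequently (Eventually.frequently ?_)
    filter_upwards [eventually_gt_atTop 0, eventually_ge_atTop ⌈r⌉₊] with n hn hr
    rw [← ENNReal.ofReal_coe_nnreal, ENNReal.ofReal_le_iff_le_toReal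
      (ENNReal.div_ne_top (measure_ne_top _ _) (hF.2.2 _).ne'), ENNReal.toReal_div]
    have hr' : (r : ℝ) ≤ n := (Nat.le_ceil r).trans (Nat.cast_le.2 hr)
    have h := succ_le_succ_rpow_div_rpow hn
    rw [← hratio n hn, tail, tail] at h
    linarith
  refine ⟨?_, hlim, fun h => (h 1 one_pos).ne hlim⟩
  filter_upwards [eventually_gt_atTop 0] with n hn
  exact ⟨hratio n hn, (hratio n hn).symm ▸ succ_le_succ_rpow_div_rpow hn⟩
end
end

section
/- The inclusion 𝒪𝒮 ∩ 𝒦 ⊆ 𝒟𝒦ᶜ is proper: there exists a heavy-tailed distribution F on [0,∞) such that F ∈ 𝒟𝒦ᶜ (indeed lim_{x→∞} x^δ F̄(x) = ∞ for every δ > 1) but F ∉ 𝒪𝒮. -/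
open MeasureTheory Filter Set Topology

noncomputable section

/-- The sparse support points `2 ^ (3 ^ n)`, each the cube of the previous one. -/
def sparsePoint (n : ℕ) : ℝ := 2 ^ 3 ^ n

theorem sparsePoint_pos (n : ℕ) : 0 < sparsePoint n := by
  unfold sparsePoint; positivity

theorem one_le_sparsePoint (n : ℕ) : 1 ≤ sparsePoint n :=
  one_le_pow₀ (by norm_num)

theorem sparsePoint_succ (n : ℕ) : sparsePoint (n + 1) = sparsePoint n ^ 3 := by
  unfold sparsePoint; rw [pow_succ, pow_mul]

theorem sparsePoint_mono : Monotone sparsePoint := fun _ _ h =>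
  pow_le_pow_right₀ (by norm_num) (Nat.pow_le_pow_right (by norm_num) h)

theorem tendsto_sparsePoint : Tendsto sparsePoint atTop atTop :=
  (tendsto_pow_atTop_atTop_of_one_lt (by norm_num)).comp
    (tendsto_pow_atTop_atTop_of_one_lt (by norm_num))

theorem exists_le_sparsePoint (y : ℝ) : ∃ n, y ≤ sparsePoint n :=
  (tendsto_sparsePoint.eventually_ge_atTop y).exists

open Classical in
/-- Rounding up to the next support point. -/
def roundUp (y : ℝ) : ℝ := sparsePoint (Nat.find (exists_le_sparsePoint y))

theorem le_roundUp (y : ℝ) : y ≤ roundUp y := by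
  classical
  exact Nat.find_spec (exists_le_sparsePoint y)

theorem roundUp_le {y : ℝ} {n : ℕ} (h : y ≤ sparsePoint n) : roundUp y ≤ sparsePoint n := by
  classical
  exact sparsePoint_mono (Nat.find_min' (exists_le_sparsePoint y) h)

theorem sparsePoint_succ_le_roundUp {y : ℝ} {n : ℕ} (h : sparsePoint n < y) :
    sparsePoint (n + 1) ≤ roundUp y := by
  classical
  refine sparsePoint_mono ?_
  rw [Nat.succ_le_iff, Nat.lt_find_iff]
  exact fun m hm => not_le.mpr ((sparsePoint_mono hm).trans_lt h)

theorem roundUp_mono : Monotone roundUp := fun _ y h => roundUp_le (h.trans (le_roundUp y))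

theorem roundUp_pos (y : ℝ) : 0 < roundUp y := sparsePoint_pos _

/-- The law of `1 / U` for `U` uniform on `(0, 1]`. -/
def inverseUniform : Measure ℝ := (volume.restrict (Ioc (0 : ℝ) 1)).map fun u => u⁻¹

instance : IsProbabilityMeasure inverseUniform := by
  have : IsProbabilityMeasure (volume.restrict (Ioc (0 : ℝ) 1)) := ⟨by simp⟩
  exact Measure.isProbabilityMeasure_map measurable_inv.aemeasurable

theorem inverseUniform_Ioi {c : ℝ} (hc : 1 ≤ c) :
    inverseUniform (Ioi c) = ENNReal.ofReal c⁻¹ := by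
  have hc0 : 0 < c := by linarith
  rw [inverseUniform, Measure.map_apply measurable_inv measurableSet_Ioi,
    Measure.restrict_apply (measurable_inv measurableSet_Ioi)]
  have : (fun u : ℝ => u⁻¹) ⁻¹' Ioi c ∩ Ioc 0 1 = Ioo 0 c⁻¹ := by
    ext u
    simp only [mem_inter_iff, mem_preimage, mem_Ioi, mem_Ioc, mem_Ioo]
    constructor
    · rintro ⟨h, h0, -⟩
      exact ⟨h0, (lt_inv_comm₀ hc0 h0).mp h⟩
    · rintro ⟨h0, h⟩
      exact ⟨(lt_inv_comm₀ h0 hc0).mp h, h0, h.le.trans (inv_le_one_of_one_le₀ hc)⟩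
  rw [this, Real.volume_Ioo, sub_zero]

/-- The law of `roundUp (1 / U)` for `U` uniform on `(0, 1]`. -/
def sparsePareto : Measure ℝ := inverseUniform.map roundUp

instance : IsProbabilityMeasure sparsePareto :=
  Measure.isProbabilityMeasure_map roundUp_mono.measurable.aemeasurable

theorem ofReal_inv_le_sparsePareto_Ioi {c : ℝ} (hc : 1 ≤ c) :
    ENNReal.ofReal c⁻¹ ≤ sparsePareto (Ioi c) := by
  rw [sparsePareto, Measure.map_apply roundUp_mono.measurable measurableSet_Ioi,
    ← inverseUniform_Ioi hc]
  exact measure_mono fun y hy => lt_of_lt_of_le hy (le_roundUp y)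

theorem sparsePareto_Ioi_sparsePoint_le (n : ℕ) :
    sparsePareto (Ioi (sparsePoint n)) ≤ ENNReal.ofReal (sparsePoint n)⁻¹ := by
  rw [sparsePareto, Measure.map_apply roundUp_mono.measurable measurableSet_Ioi,
    ← inverseUniform_Ioi (one_le_sparsePoint n)]
  refine measure_mono fun y hy => ?_
  by_contra h
  exact absurd (roundUp_le (not_lt.mp h)) (not_le.mpr hy)

theorem ofReal_inv_le_sparsePareto_Ici (n : ℕ) :
    ENNReal.ofReal (sparsePoint n)⁻¹ ≤ sparsePareto (Ici (sparsePoint (n + 1))) := by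
  rw [sparsePareto, Measure.map_apply roundUp_mono.measurable measurableSet_Ici,
    ← inverseUniform_Ioi (one_le_sparsePoint n)]
  exact measure_mono fun y hy => sparsePoint_succ_le_roundUp hy

theorem isDistribution_sparsePareto : IsDistribution sparsePareto := by
  refine ⟨inferInstance, ?_, fun x => ?_⟩
  · rw [sparsePareto, Measure.map_apply roundUp_mono.measurable measurableSet_Iio]
    have : roundUp ⁻¹' Iio 0 = ∅ := by
      ext y
      simp [(roundUp_pos y).le]
    rw [this, measure_empty]
  · have h1 : (1 : ℝ) ≤ max x 1 := le_max_right _ _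
    calc 0 < ENNReal.ofReal (max x 1)⁻¹ := by
          rw [ENNReal.ofReal_pos, inv_pos]; linarith
      _ ≤ sparsePareto (Ioi (max x 1)) := ofReal_inv_le_sparsePareto_Ioi h1
      _ ≤ sparsePareto (Ioi x) := measure_mono (Ioi_subset_Ioi (le_max_left _ _))

theorem inv_le_tail_sparsePareto {c : ℝ} (hc : 1 ≤ c) : c⁻¹ ≤ tail sparsePareto c := by
  rw [tail, ← ENNReal.ofReal_le_iff_le_toReal (measure_ne_top _ _)]
  exact ofReal_inv_le_sparsePareto_Ioi hc

theorem tendsto_rpow_mul_tail_sparsePareto {δ : ℝ} (hδ : 1 < δ) :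
    Tendsto (fun y : ℝ => y ^ δ * tail sparsePareto y) atTop atTop := by
  refine tendsto_atTop_mono' _ ?_ (tendsto_rpow_atTop (sub_pos.mpr hδ))
  filter_upwards [eventually_ge_atTop 1] with y hy
  have hy0 : 0 < y := by linarith
  rw [Real.rpow_sub hy0, Real.rpow_one, div_eq_mul_inv]
  exact mul_le_mul_of_nonneg_left (inv_le_tail_sparsePareto hy) (by positivity)

theorem stronglyHeavyTailed_sparsePareto : StronglyHeavyTailed sparsePareto := by
  intro l hl
  have h := tendsto_exp_mul_div_rpow_atTop 1 l hl
  refine tendsto_atTop_mono' _ ?_ h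
  filter_upwards [eventually_ge_atTop 1] with y hy
  rw [Real.rpow_one, div_eq_mul_inv]
  exact mul_le_mul_of_nonneg_left (inv_le_tail_sparsePareto hy) (Real.exp_pos _).le

/-- Markov's inequality: `e^{ax} F̄(x)` is a lower bound for the exponential moment of order `a`. -/
theorem StronglyHeavyTailed.heavyTailed {F : Measure ℝ} [IsFiniteMeasure F]
    (hF : StronglyHeavyTailed F) : HeavyTailed F := by
  intro a ha
  have key (x : ℝ) : ENNReal.ofReal (Real.exp (a * x) * tail F x) ≤
      ∫⁻ y, ENNReal.ofReal (Real.exp (a * y)) ∂F := by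
    rw [ENNReal.ofReal_mul (Real.exp_pos _).le, tail, ENNReal.ofReal_toReal (measure_ne_top _ _),
      ← setLIntegral_const]
    refine (setLIntegral_mono' measurableSet_Ioi fun y hy => ?_).trans (setLIntegral_le_lintegral _ _)
    exact ENNReal.ofReal_le_ofReal
      (Real.exp_le_exp.mpr (mul_le_mul_of_nonneg_left (le_of_lt hy) ha.le))
  exact top_le_iff.mp
    (le_of_tendsto' (ENNReal.tendsto_ofReal_atTop.comp (hF a ha)) key)

theorem sq_measure_Ici_le_conv2_Ioi {F : Measure ℝ} [SFinite F] {x : ℝ} (hx : 0 < x) :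
    F (Ici x) ^ 2 ≤ conv2 F (Ioi x) := by
  rw [conv2, Measure.map_apply (by fun_prop) measurableSet_Ioi, sq, ← Measure.prod_prod]
  refine measure_mono fun p hp => ?_
  have h1 : x ≤ p.1 := hp.1
  have h2 : x ≤ p.2 := hp.2
  simp only [mem_preimage, mem_Ioi]
  linarith

theorem ofReal_sparsePoint_le_conv2_div (n : ℕ) :
    ENNReal.ofReal (sparsePoint n) ≤ conv2 sparsePareto (Ioi (sparsePoint (n + 1))) /
      sparsePareto (Ioi (sparsePoint (n + 1))) := by
  have h0 := sparsePoint_pos n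
  have h1 := sparsePoint_pos (n + 1)
  calc ENNReal.ofReal (sparsePoint n)
      = ENNReal.ofReal (sparsePoint n)⁻¹ ^ 2 / ENNReal.ofReal (sparsePoint (n + 1))⁻¹ := by
        rw [← ENNReal.ofReal_pow (inv_pos.mpr h0).le,
          ← ENNReal.ofReal_div_of_pos (inv_pos.mpr h1), sparsePoint_succ]
        congr 1
        field_simp
    _ ≤ _ := ENNReal.div_le_div
        ((pow_le_pow_left' (ofReal_inv_le_sparsePareto_Ici n) 2).trans
          (sq_measure_Ici_le_conv2_Ioi h1))
        (sparsePareto_Ioi_sparsePoint_le (n + 1))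

theorem not_memOS_sparsePareto : ¬ MemOS sparsePareto := by
  intro h
  obtain ⟨b, hb, hbt⟩ := exists_between h
  have hev := (tendsto_sparsePoint.comp (tendsto_add_atTop_nat 1)).eventually
    (eventually_lt_of_limsup_lt hb)
  have hlim := (ENNReal.tendsto_ofReal_atTop.comp tendsto_sparsePoint).eventually (lt_mem_nhds hbt)
  obtain ⟨n, hn, hn'⟩ := (hev.and hlim).exists
  exact lt_asymm hn (lt_of_lt_of_le hn' (ofReal_sparsePoint_le_conv2_div n))

/-- the inclusion `𝒪𝒮 ∩ 𝒦 ⊆ 𝒟𝒦ᶜ` is proper: there is a heavy-tailed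
distribution `F` which is strongly heavy-tailed (indeed `x^δ F̄(x) → ∞` for every `δ > 1`)
but `F ∉ 𝒪𝒮`. -/
theorem os_inter_heavy_proper_in_stronglyHeavy :
    ∃ F : Measure ℝ, IsDistribution F ∧ HeavyTailed F ∧
      StronglyHeavyTailed F ∧
      (∀ δ : ℝ, 1 < δ →
        Filter.Tendsto (fun y : ℝ => y ^ δ * tail F y) Filter.atTop Filter.atTop) ∧
      ¬ MemOS F := by
  exact ⟨sparsePareto, isDistribution_sparsePareto, stronglyHeavyTailed_sparsePareto.heavyTailed,
    stronglyHeavyTailed_sparsePareto, fun _ hδ => tendsto_rpow_mul_tail_sparsePareto hδ,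
    not_memOS_sparsePareto⟩
end
end

section
/- There exists a heavy-tailed distribution F on [0,∞) such that F ∈ 𝒥, F ∉ ℒ, F ∉ 𝒟, F ∈ 𝒟𝒦₁, and F is not weakly tail equivalent to any subexponential distribution G ∈ 𝒮. -/
open MeasureTheory Filter Set Topology

noncomputable section

lemma IsDistribution.measureReal_Ici_zero {F : Measure ℝ} (hF : IsDistribution F) :
    F.real (Ici 0) = 1 := by
  have := hF.1
  rw [← compl_Iio, probReal_compl_eq_one_sub measurableSet_Iio, measureReal_def, hF.2.1]
  simp

lemma tail_tendsto_zero (F : Measure ℝ) [IsFiniteMeasure F] :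
    Tendsto (tail F) atTop (𝓝 0) := by
  have h : Tendsto (fun x : ℝ => F (Ioi x)) atTop (𝓝 (F (⋂ x : ℝ, Ioi x))) :=
    tendsto_measure_iInter_atTop (fun _ => measurableSet_Ioi.nullMeasurableSet)
      (fun _ _ h => Ioi_subset_Ioi h) ⟨0, measure_ne_top _ _⟩
  have he : (⋂ x : ℝ, Ioi x) = ∅ := by
    ext y
    simp only [mem_iInter, mem_Ioi, mem_empty_iff_false, iff_false, not_forall, not_lt]
    exact ⟨y, le_rfl⟩
  rw [he, measure_empty] at h
  exact (ENNReal.tendsto_toReal ENNReal.zero_ne_top).comp h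

/-- Splitting `X₁ + X₂ > x` according to whether `X₁ > x`, `X₁ ≤ t` or `t < X₁ ≤ x`. -/
lemma IsDistribution.le_conv2_tail {G : Measure ℝ} (hG : IsDistribution G) {t x : ℝ} (ht : 0 ≤ t)
    (htx : t ≤ x) :
    tail G x + (1 - tail G t) * tail G x + (tail G t - tail G x) * tail G (x - t)
      ≤ (conv2 G (Ioi x)).toReal := by
  have := hG.1
  have h1 : G.real (Icc 0 t) = 1 - tail G t := by
    have : Icc 0 t = Ici 0 \ Ioi t := by ext; simp
    rw [this, measureReal_sdiff (Ioi_subset_Ici ht) measurableSet_Ioi,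
      hG.measureReal_Ici_zero]
    rfl
  have h2 : G.real (Ioc t x) = tail G t - tail G x := by
    have : Ioc t x = Ioi t \ Ioi x := by ext; simp
    rw [this, measureReal_sdiff (Ioi_subset_Ioi htx) measurableSet_Ioi]
    rfl
  have hA : (G.prod G).real (Ioi x ×ˢ Ici 0) = tail G x := by
    rw [measureReal_prod_prod, hG.measureReal_Ici_zero, mul_one]; rfl
  have hB : (G.prod G).real (Icc 0 t ×ˢ Ioi x) = (1 - tail G t) * tail G x := by
    rw [measureReal_prod_prod, h1]; rfl
  have hC : (G.prod G).real (Ioc t x ×ˢ Ioi (x - t))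
      = (tail G t - tail G x) * tail G (x - t) := by
    rw [measureReal_prod_prod, h2]; rfl
  have hconv : (conv2 G (Ioi x)).toReal = (G.prod G).real {p | x < p.1 + p.2} := by
    rw [conv2, Measure.map_apply (by fun_prop) measurableSet_Ioi]; rfl
  rw [hconv, ← hC, ← hB, ← hA, ← measureReal_union, ← measureReal_union]
  · refine measureReal_mono ?_
    rintro ⟨p, q⟩ h
    simp only [mem_union, mem_prod, mem_Ioi, mem_Ici, mem_Icc, mem_Ioc, mem_ofPred_eq] at h ⊢
    rcases h with (h | h) | h <;> linarith [h.1, h.2]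
  · rw [Set.disjoint_left]
    rintro ⟨p, q⟩ h h'
    simp only [mem_union, mem_prod, mem_Ioi, mem_Ici, mem_Icc, mem_Ioc] at h h'
    rcases h with h | h <;> linarith [h.1, h'.1.1, h'.1.2]
  · exact measurableSet_Ioc.prod measurableSet_Ioi
  · rw [Set.disjoint_left]
    rintro ⟨p, q⟩ h h'
    simp only [mem_prod, mem_Ioi, mem_Ici, mem_Icc] at h h'
    linarith [h.1, h'.1.2]
  · exact measurableSet_Icc.prod measurableSet_Ioi

lemma MemS.eventually_tail_sub_le {G : Measure ℝ} (hG : IsDistribution G) (hS : MemS G) {t : ℝ}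
    (ht : 0 ≤ t) : ∀ᶠ x in atTop, tail G (x - t) ≤ 2 * tail G x := by
  have := hG.1
  have hg := hG.tail_pos t
  filter_upwards [hS.eventually (gt_mem_nhds (show (2 : ℝ) < 2 + tail G t / 2 by linarith)),
    (tail_tendsto_zero G).eventually (gt_mem_nhds (show 0 < tail G t / 4 by linarith)),
    eventually_ge_atTop t] with x h1 h2 h3
  have hx := hG.tail_pos x
  have h4 := hG.le_conv2_tail ht h3
  rw [div_lt_iff₀ hx] at h1
  by_contra! h
  have : (tail G t - tail G x) * (2 * tail G x) ≤ (tail G t - tail G x) * tail G (x - t) :=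
    mul_le_mul_of_nonneg_left h.le (by linarith)
  nlinarith

/-- A distribution that is weakly tail equivalent to a subexponential one has tail ratios
`F̄(x - t) / F̄(x)` that are asymptotically bounded uniformly in `t`. -/
lemma not_weakTailEquiv_memS {F : Measure ℝ} (hF : IsDistribution F)
    (h : ∀ M : ℝ, ∃ t : ℝ, 0 ≤ t ∧ ∃ᶠ x in atTop, M * tail F x < tail F (x - t)) :
    ¬ ∃ G : Measure ℝ, IsDistribution G ∧ MemS G ∧ WeakTailEquiv F G := by
  rintro ⟨G, hG, hS, hinf, hsup⟩
  have := hF.1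
  have := hG.1
  have hne : ∀ x, G (Ioi x) ≠ 0 := fun x => (hG.2.2 x).ne'
  obtain ⟨c, hc0, hc⟩ := exists_between hinf
  obtain ⟨C, hC, hC1⟩ := exists_between hsup
  have hlow : ∀ᶠ x in atTop, c.toReal * tail G x ≤ tail F x := by
    filter_upwards [eventually_lt_of_lt_liminf hc] with x hx
    have := (ENNReal.le_div_iff_mul_le (.inl (hne x)) (.inl (measure_ne_top _ _))).1 hx.le
    rw [tail, tail, ← ENNReal.toReal_mul]
    exact ENNReal.toReal_mono (measure_ne_top _ _) this
  have hup : ∀ᶠ x in atTop, tail F x ≤ C.toReal * tail G x := by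
    filter_upwards [eventually_lt_of_limsup_lt hC] with x hx
    have := (ENNReal.div_le_iff (hne x) (measure_ne_top _ _)).1 hx.le
    rw [tail, tail, ← ENNReal.toReal_mul]
    exact ENNReal.toReal_mono (ENNReal.mul_ne_top hC1.ne (measure_ne_top _ _)) this
  have hcpos : 0 < c.toReal := ENNReal.toReal_pos hc0.ne' (hc.trans_le le_top).ne
  obtain ⟨t, ht, hfreq⟩ := h (C.toReal * 2 / c.toReal)
  refine hfreq ?_
  filter_upwards [hlow, (tendsto_atTop_add_const_right atTop (-t) tendsto_id).eventually hup,
    hS.eventually_tail_sub_le hG ht] with x h1 h2 h3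
  simp only [id, ← sub_eq_add_neg] at h2
  rw [not_lt]
  calc tail F (x - t) ≤ C.toReal * (2 * tail G x) :=
        h2.trans (mul_le_mul_of_nonneg_left h3 ENNReal.toReal_nonneg)
    _ = C.toReal * 2 / c.toReal * (c.toReal * tail G x) := by field_simp
    _ ≤ _ := mul_le_mul_of_nonneg_left h1 (by positivity)

lemma not_memD_of_frequently {F : Measure ℝ} (hF : IsDistribution F)
    (h : ∀ M : ℝ, ∃ t : ℝ, 0 ≤ t ∧ ∃ᶠ x in atTop, M * tail F x < tail F (x - t)) :
    ¬ MemD F := by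
  intro hD
  have := hF.1
  obtain ⟨C, hC, hC1⟩ := exists_between hD
  obtain ⟨t, ht, hfreq⟩ := h C.toReal
  refine hfreq ?_
  filter_upwards [eventually_lt_of_limsup_lt hC, eventually_ge_atTop (2 * t)] with x hx hxt
  have h1 := (ENNReal.div_le_iff (hF.2.2 x).ne' (measure_ne_top _ _)).1 hx.le
  rw [not_lt, tail, tail, ← ENNReal.toReal_mul]
  refine ENNReal.toReal_mono (ENNReal.mul_ne_top hC1.ne (measure_ne_top _ _)) (le_trans ?_ h1)
  exact measure_mono (Ioi_subset_Ioi (by linarith))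

lemma not_memL_of_frequently {F : Measure ℝ} (hF : IsDistribution F)
    (h : ∀ M : ℝ, ∃ t : ℝ, 0 ≤ t ∧ ∃ᶠ x in atTop, M * tail F x < tail F (x - t)) :
    ¬ MemL F := by
  intro hL
  obtain ⟨t, ht, hfreq⟩ := h 2
  have ht0 : t ≠ 0 := by
    rintro rfl
    refine hfreq (Eventually.of_forall fun x => ?_)
    have := hF.tail_pos x
    simp only [sub_zero]
    linarith
  refine hfreq ?_
  filter_upwards [(hL t (lt_of_le_of_ne ht ht0.symm)).eventually
    (gt_mem_nhds (show (1 : ℝ) < 2 by norm_num))] with x hx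
  rw [div_lt_iff₀ (hF.tail_pos x)] at hx
  exact hx.not_gt

lemma MemDK1.heavyTailed {F : Measure ℝ} (hF : IsDistribution F) (h : MemDK1 F) :
    HeavyTailed F := by
  have := hF.1
  obtain ⟨δ, -, hδ⟩ := h
  intro a ha
  refine ENNReal.eq_top_of_forall_nnreal_le fun r => ?_
  obtain ⟨x, h1, h2, h3⟩ := ((hδ.eventually_ge_atTop 1).and
    (((tendsto_exp_mul_div_rpow_atTop δ a ha).eventually_ge_atTop r).and
      (eventually_gt_atTop 0))).exists
  have hx : (0 : ℝ) < x ^ δ := Real.rpow_pos_of_pos h3 δ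
  have hr : (r : ℝ) ≤ Real.exp (a * x) * tail F x := by
    calc (r : ℝ) ≤ Real.exp (a * x) / x ^ δ * 1 := by rwa [mul_one]
      _ ≤ Real.exp (a * x) / x ^ δ * (x ^ δ * tail F x) := by gcongr
      _ = _ := by field_simp
  calc (r : ENNReal) = ENNReal.ofReal r := by simp
    _ ≤ ENNReal.ofReal (Real.exp (a * x) * tail F x) := ENNReal.ofReal_le_ofReal hr
    _ = ENNReal.ofReal (Real.exp (a * x)) * F (Ioi x) := by
        rw [ENNReal.ofReal_mul (Real.exp_pos _).le, tail, ENNReal.ofReal_toReal (measure_ne_top _ _)]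
    _ = ∫⁻ _ in Ioi x, ENNReal.ofReal (Real.exp (a * x)) ∂F := by simp
    _ ≤ ∫⁻ y in Ioi x, ENNReal.ofReal (Real.exp (a * y)) ∂F := by
        refine setLIntegral_mono' measurableSet_Ioi fun y hy => ?_
        gcongr
        exact le_of_lt hy
    _ ≤ _ := setLIntegral_le_lintegral _ _

/-- Two big jumps with the first one the smaller, in terms of a truncated first moment. -/
lemma prod_two_big_jumps_le {F : Measure ℝ} [IsProbabilityMeasure F] {C : ℝ} (hC : 0 ≤ C)
    (hT : ∀ x y : ℝ, 0 ≤ y → y ≤ x / 2 →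
      F (Ioi (x - y)) ≤ ENNReal.ofReal (C * (1 + y)) * F (Ioi x))
    {K x : ℝ} (hK : 0 ≤ K) (hx : 0 ≤ x) :
    (F.prod F) {p | K < p.1 ∧ p.1 ≤ p.2 ∧ x < p.1 + p.2} ≤
      ENNReal.ofReal C * F (Ioi x) * ∫⁻ y in Ioi K, ENNReal.ofReal (1 + y) ∂F := by
  have hm : MeasurableSet {p : ℝ × ℝ | K < p.1 ∧ p.1 ≤ p.2 ∧ x < p.1 + p.2} := by
    measurability
  rw [Measure.prod_apply hm, ← lintegral_const_mul _ (by fun_prop),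
    ← lintegral_indicator measurableSet_Ioi]
  refine lintegral_mono fun y => ?_
  by_cases hy : K < y
  · rw [indicator_of_mem (show y ∈ Ioi K from hy)]
    have hsub : Prod.mk y ⁻¹' {p : ℝ × ℝ | K < p.1 ∧ p.1 ≤ p.2 ∧ x < p.1 + p.2}
        ⊆ Ioi (x - min y (x / 2)) := by
      rintro z ⟨-, h1, h2⟩
      simp only [mem_Ioi] at h1 h2 ⊢
      rcases min_choice y (x / 2) with h | h <;> rw [h] <;> linarith
    have h0 : 0 ≤ min y (x / 2) := le_min (by linarith) (by linarith)
    calc F (Prod.mk y ⁻¹' {p : ℝ × ℝ | K < p.1 ∧ p.1 ≤ p.2 ∧ x < p.1 + p.2})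
        ≤ F (Ioi (x - min y (x / 2))) := measure_mono hsub
      _ ≤ ENNReal.ofReal (C * (1 + min y (x / 2))) * F (Ioi x) := hT _ _ h0 (min_le_right _ _)
      _ ≤ ENNReal.ofReal (C * (1 + y)) * F (Ioi x) := by gcongr; exact min_le_left _ _
      _ = _ := by rw [ENNReal.ofReal_mul hC]; ring
  · have : Prod.mk y ⁻¹' {p : ℝ × ℝ | K < p.1 ∧ p.1 ≤ p.2 ∧ x < p.1 + p.2} = ∅ := by
      ext z
      simp [hy]
    rw [this, measure_empty]
    exact zero_le

lemma memJ_of_finite_mean {F : Measure ℝ} (hF : IsDistribution F) {C : ℝ} (hC : 0 ≤ C)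
    (hmean : ∫⁻ y, ENNReal.ofReal (1 + y) ∂F ≠ ⊤)
    (hT : ∀ x y : ℝ, 0 ≤ y → y ≤ x / 2 →
      F (Ioi (x - y)) ≤ ENNReal.ofReal (C * (1 + y)) * F (Ioi x)) :
    MemJ F := by
  have := hF.1
  have htail : Tendsto (fun K : ℝ => F (Ioi K)) atTop (𝓝 0) := by
    have := ENNReal.tendsto_ofReal (tail_tendsto_zero F)
    simpa only [tail, ENNReal.ofReal_toReal (measure_ne_top F _), ENNReal.ofReal_zero] using this
  have hlim : Tendsto (fun K : ℝ => (2 * C) *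
      (∫⁻ y in Ioi K, ENNReal.ofReal (1 + y) ∂F).toReal) atTop (𝓝 0) := by
    have := (ENNReal.tendsto_toReal ENNReal.zero_ne_top).comp
      (tendsto_setLIntegral_zero hmean htail)
    simpa using this.const_mul (2 * C)
  have hratio_le : ∀ K x : ℝ,
      ((F.prod F) {p : ℝ × ℝ | min p.1 p.2 ≤ K ∧ x < p.1 + p.2}).toReal /
        ((F.prod F) {p : ℝ × ℝ | x < p.1 + p.2}).toReal ≤ 1 := fun K x =>
    div_le_one_of_le₀ (ENNReal.toReal_mono (measure_ne_top _ _)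
      (measure_mono fun p hp => hp.2)) ENNReal.toReal_nonneg
  have hratio_ge : ∀ K x : ℝ, 0 ≤ K → 0 ≤ x →
      1 - (2 * C) * (∫⁻ y in Ioi K, ENNReal.ofReal (1 + y) ∂F).toReal ≤
      ((F.prod F) {p : ℝ × ℝ | min p.1 p.2 ≤ K ∧ x < p.1 + p.2}).toReal /
        ((F.prod F) {p : ℝ × ℝ | x < p.1 + p.2}).toReal := by
    intro K x hK hx
    set I := (∫⁻ y in Ioi K, ENNReal.ofReal (1 + y) ∂F) with hI
    have hItop : I ≠ ⊤ := ne_top_of_le_ne_top hmean (setLIntegral_le_lintegral _ _)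
    set D : Set (ℝ × ℝ) := {p | K < p.1 ∧ p.1 ≤ p.2 ∧ x < p.1 + p.2} with hD
    have hDm : MeasurableSet D := by
      rw [hD]; measurability
    have hDle : (F.prod F).real D ≤ C * tail F x * I.toReal := by
      have h := ENNReal.toReal_mono
        (ENNReal.mul_ne_top (ENNReal.mul_ne_top ENNReal.ofReal_ne_top (measure_ne_top _ _)) hItop)
        (prod_two_big_jumps_le hC hT hK hx)
      rwa [ENNReal.toReal_mul, ENNReal.toReal_mul, ENNReal.toReal_ofReal hC] at h
    have hDswap : (F.prod F).real (Prod.swap ⁻¹' D) = (F.prod F).real D := by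
      rw [measureReal_def, measureReal_def, ← Measure.map_apply measurable_swap hDm,
        Measure.prod_swap]
    have hB : tail F x ≤ (F.prod F).real {p : ℝ × ℝ | x < p.1 + p.2} := by
      have h : (F.prod F).real (Ioi x ×ˢ Ici 0) = tail F x := by
        rw [measureReal_prod_prod, hF.measureReal_Ici_zero, mul_one]; rfl
      rw [← h]
      refine measureReal_mono ?_
      rintro ⟨p, q⟩ ⟨h1, h2⟩
      simp only [mem_Ioi, mem_Ici, mem_ofPred_eq] at h1 h2 ⊢
      linarith
    have hsplit : (F.prod F).real {p : ℝ × ℝ | x < p.1 + p.2} ≤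
        (F.prod F).real {p : ℝ × ℝ | min p.1 p.2 ≤ K ∧ x < p.1 + p.2} +
          ((F.prod F).real D + (F.prod F).real (Prod.swap ⁻¹' D)) := by
      refine (measureReal_mono ?_).trans ((measureReal_union_le _ _).trans
        (add_le_add_right (measureReal_union_le _ _) _))
      rintro ⟨p, q⟩ h
      simp only [hD, mem_ofPred_eq, mem_union, mem_preimage, Prod.swap_prod_mk] at h ⊢
      by_cases hm : min p q ≤ K
      · exact Or.inl ⟨hm, h⟩
      · rw [not_le, lt_min_iff] at hm
        rcases le_total p q with h' | h'
        · exact Or.inr (Or.inl ⟨hm.1, h', h⟩)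
        · exact Or.inr (Or.inr ⟨hm.2, h', by linarith⟩)
    rw [← measureReal_def, ← measureReal_def, le_div_iff₀ ((hF.tail_pos x).trans_le hB)]
    have : C * tail F x * I.toReal
        ≤ C * (F.prod F).real {p : ℝ × ℝ | x < p.1 + p.2} * I.toReal := by gcongr
    rw [hDswap] at hsplit
    linarith
  have hbdd : ∀ K : ℝ, IsBoundedUnder (· ≤ ·) atTop (fun x : ℝ =>
      ((F.prod F) {p : ℝ × ℝ | min p.1 p.2 ≤ K ∧ x < p.1 + p.2}).toReal /
        ((F.prod F) {p : ℝ × ℝ | x < p.1 + p.2}).toReal) := fun K =>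
    isBoundedUnder_of ⟨1, hratio_le K⟩
  have hbdd' : ∀ K : ℝ, IsBoundedUnder (· ≥ ·) atTop (fun x : ℝ =>
      ((F.prod F) {p : ℝ × ℝ | min p.1 p.2 ≤ K ∧ x < p.1 + p.2}).toReal /
        ((F.prod F) {p : ℝ × ℝ | x < p.1 + p.2}).toReal) := fun K =>
    isBoundedUnder_of ⟨0, fun x => by positivity⟩
  refine tendsto_of_tendsto_of_tendsto_of_le_of_le'
    (by simpa using hlim.const_sub 1) tendsto_const_nhds ?_ ?_
  · filter_upwards [eventually_ge_atTop 0] with K hK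
    refine le_liminf_of_le (hbdd K).isCoboundedUnder_ge ?_
    filter_upwards [eventually_ge_atTop 0] with x hx using hratio_ge K x hK hx
  · refine Eventually.of_forall fun K => ?_
    exact liminf_le_of_le (hbdd' K) fun b hb =>
      let ⟨x, hx⟩ := hb.exists
      hx.trans (hratio_le K x)

/-- The locations of the drops of the tail constructed below. -/
def dropPoint (n : ℕ) : ℝ := 2 ^ 2 ^ n

lemma two_le_dropPoint (n : ℕ) : 2 ≤ dropPoint n := by
  have : (2 : ℝ) ^ 1 ≤ 2 ^ 2 ^ n := pow_le_pow_right₀ (by norm_num) Nat.one_le_two_pow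
  simpa [dropPoint] using this

lemma dropPoint_succ (n : ℕ) : dropPoint (n + 1) = dropPoint n ^ 2 := by
  rw [dropPoint, dropPoint, ← pow_mul, pow_succ]

lemma dropPoint_mono : Monotone dropPoint := by
  refine monotone_nat_of_le_succ fun n => ?_
  rw [dropPoint_succ]
  nlinarith [two_le_dropPoint n]

lemma sq_dropPoint_le {m n : ℕ} (h : m < n) : dropPoint m ^ 2 ≤ dropPoint n := by
  rw [← dropPoint_succ]
  exact dropPoint_mono h

lemma tendsto_dropPoint : Tendsto dropPoint atTop atTop :=
  (tendsto_pow_atTop_atTop_of_one_lt (by norm_num)).comp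
    (tendsto_pow_atTop_atTop_of_one_lt (by norm_num))

/-- A tail that decays like `1 / s` at distance `s` after the drop point `dropPoint n`, on top of a
global decay of order `x⁻²`. -/
def dropTail (n : ℕ) (x : ℝ) : ℝ :=
  ((1 + max (x - dropPoint n) 0) * max (dropPoint n) x ^ 2)⁻¹

lemma dropTail_den_pos (n : ℕ) (x : ℝ) :
    0 < (1 + max (x - dropPoint n) 0) * max (dropPoint n) x ^ 2 := by
  have h1 := two_le_dropPoint n
  have h2 := le_max_left (dropPoint n) x
  have h3 := le_max_right (x - dropPoint n) 0
  have : 0 < max (dropPoint n) x := by linarith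
  positivity

lemma dropTail_pos (n : ℕ) (x : ℝ) : 0 < dropTail n x := inv_pos.2 (dropTail_den_pos n x)

lemma dropTail_anti (n : ℕ) : Antitone (dropTail n) := by
  intro x y hxy
  have h : 0 ≤ max (dropPoint n) x := le_max_of_le_left (by linarith [two_le_dropPoint n])
  refine inv_anti₀ (dropTail_den_pos n x) ?_
  gcongr

lemma continuous_dropTail (n : ℕ) : Continuous (dropTail n) := by
  unfold dropTail
  exact Continuous.inv₀ (by fun_prop) fun x => (dropTail_den_pos n x).ne'

lemma dropTail_le_inv_sq {x c : ℝ} (n : ℕ) (hc : 0 < c) (h : c ≤ max (dropPoint n) x) :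
    dropTail n x ≤ (c ^ 2)⁻¹ := by
  have h3 := le_max_right (x - dropPoint n) 0
  refine inv_anti₀ (by positivity) ?_
  have : c ^ 2 ≤ max (dropPoint n) x ^ 2 := by gcongr
  nlinarith [sq_nonneg c]

lemma dropTail_le_one (n : ℕ) (x : ℝ) : dropTail n x ≤ 1 := by
  simpa using dropTail_le_inv_sq n one_pos
    (show 1 ≤ max (dropPoint n) x from le_max_of_le_left (by linarith [two_le_dropPoint n]))

lemma dropTail_sub_le (n : ℕ) {x y : ℝ} (hy : 0 ≤ y) (hyx : y ≤ x / 2) :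
    dropTail n (x - y) ≤ 4 * (1 + y) * dropTail n x := by
  have ha := two_le_dropPoint n
  have h1 : 1 + max (x - dropPoint n) 0 ≤ (1 + y) * (1 + max (x - y - dropPoint n) 0) := by
    have h2 := le_max_left (x - y - dropPoint n) 0
    have h3 := le_max_right (x - y - dropPoint n) 0
    have h4 := mul_nonneg hy h3
    have : max (x - dropPoint n) 0 ≤ y + max (x - y - dropPoint n) 0 :=
      max_le (by linarith) (by linarith)
    linarith
  have h2 : max (dropPoint n) x ≤ 2 * max (dropPoint n) (x - y) := by
    have h2 := le_max_left (dropPoint n) (x - y)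
    have h3 := le_max_right (dropPoint n) (x - y)
    exact max_le (by linarith) (by linarith)
  have h3 : 0 < max (dropPoint n) x := lt_max_of_lt_left (by linarith)
  have h4 : max (dropPoint n) x ^ 2 ≤ 4 * max (dropPoint n) (x - y) ^ 2 := by
    calc max (dropPoint n) x ^ 2 ≤ (2 * max (dropPoint n) (x - y)) ^ 2 := by gcongr
      _ = _ := by ring
  have h5 : 0 ≤ 1 + max (x - dropPoint n) 0 := by positivity
  rw [dropTail, dropTail, ← div_eq_mul_inv, inv_eq_one_div,
    div_le_div_iff₀ (dropTail_den_pos n _) (dropTail_den_pos n _), one_mul]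
  calc (1 + max (x - dropPoint n) 0) * max (dropPoint n) x ^ 2
      ≤ ((1 + y) * (1 + max (x - y - dropPoint n) 0)) * (4 * max (dropPoint n) (x - y) ^ 2) := by
        gcongr
    _ = _ := by ring

/-- After a drop point all the tails `dropTail k` are small. -/
lemma dropTail_dropPoint_add_le {n : ℕ} {t : ℝ} (ht : 0 ≤ t) (hn : 2 * (1 + t) ≤ dropPoint n)
    (k : ℕ) : dropTail k (dropPoint n + t) ≤ ((1 + t) * dropPoint n ^ 2)⁻¹ := by
  have ha := two_le_dropPoint n
  rcases lt_or_ge n k with h | h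
  · have hk := sq_dropPoint_le h
    refine (dropTail_le_inv_sq k (by positivity) (hk.trans (le_max_left _ _))).trans ?_
    refine inv_anti₀ (by positivity) ?_
    rw [sq (dropPoint n ^ 2)]
    gcongr
    nlinarith
  · have h1 : t ≤ dropPoint n + t - dropPoint k := by linarith [dropPoint_mono h]
    refine inv_anti₀ (by positivity) ?_
    gcongr
    · exact h1.trans (le_max_left _ _)
    · exact (le_add_of_nonneg_right ht).trans (le_max_right _ _)

/-- The supremum of the tails `dropTail n`. -/
def supTail (x : ℝ) : ℝ := ⨆ n, dropTail n x

lemma bddAbove_dropTail (x : ℝ) : BddAbove (range fun n => dropTail n x) :=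
  ⟨1, by rintro _ ⟨n, rfl⟩; exact dropTail_le_one n x⟩

lemma dropTail_le_supTail (n : ℕ) (x : ℝ) : dropTail n x ≤ supTail x :=
  le_ciSup (bddAbove_dropTail x) n

lemma supTail_pos (x : ℝ) : 0 < supTail x := (dropTail_pos 0 x).trans_le (dropTail_le_supTail 0 x)

lemma supTail_le_one (x : ℝ) : supTail x ≤ 1 := ciSup_le fun n => dropTail_le_one n x

lemma supTail_le_inv_sq {x : ℝ} (hx : 0 < x) : supTail x ≤ (x ^ 2)⁻¹ :=
  ciSup_le fun n => dropTail_le_inv_sq n hx (le_max_right _ _)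

lemma supTail_anti : Antitone supTail := fun _ _ h =>
  ciSup_le fun n => (dropTail_anti n h).trans (dropTail_le_supTail n _)

lemma supTail_sub_le {x y : ℝ} (hy : 0 ≤ y) (hyx : y ≤ x / 2) :
    supTail (x - y) ≤ 4 * (1 + y) * supTail x :=
  ciSup_le fun n => (dropTail_sub_le n hy hyx).trans
    (mul_le_mul_of_nonneg_left (dropTail_le_supTail n x) (by positivity))

lemma supTail_drop {n : ℕ} {t : ℝ} (ht : 0 ≤ t) (hn : 2 * (1 + t) ≤ dropPoint n) :
    (1 + t) * supTail (dropPoint n + t) ≤ supTail (dropPoint n) := by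
  have ha := two_le_dropPoint n
  have h1 : supTail (dropPoint n + t) ≤ ((1 + t) * dropPoint n ^ 2)⁻¹ :=
    ciSup_le fun k => dropTail_dropPoint_add_le ht hn k
  have h2 : (dropPoint n ^ 2)⁻¹ ≤ supTail (dropPoint n) := by
    simpa [dropTail] using dropTail_le_supTail n (dropPoint n)
  calc (1 + t) * supTail (dropPoint n + t) ≤ (1 + t) * ((1 + t) * dropPoint n ^ 2)⁻¹ := by gcongr
    _ = (dropPoint n ^ 2)⁻¹ := by field_simp
    _ ≤ _ := h2

lemma inv_cube_le_supTail {x : ℝ} (hx : 2 ≤ x) : (x ^ 3)⁻¹ ≤ supTail x := by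
  refine le_trans ?_ (dropTail_le_supTail 0 x)
  have h0 : dropPoint 0 = 2 := by norm_num [dropPoint]
  refine inv_anti₀ (dropTail_den_pos 0 x) ?_
  rw [h0, max_eq_right hx, max_eq_left (by linarith)]
  nlinarith [sq_nonneg x]

lemma continuousWithinAt_supTail (x : ℝ) : ContinuousWithinAt supTail (Ici x) x := by
  refine tendsto_order.2 ⟨fun a ha => ?_, fun a ha => ?_⟩
  · obtain ⟨n, hn⟩ := exists_lt_of_lt_ciSup ha
    have := ((continuous_dropTail n).tendsto x).eventually (lt_mem_nhds hn)
    filter_upwards [nhdsWithin_le_nhds this] with y hy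
    exact hy.trans_le (dropTail_le_supTail n y)
  · filter_upwards [self_mem_nhdsWithin] with y hy
    exact (supTail_anti hy).trans_lt ha

/-- The distribution function with tail `supTail` on `[0, ∞)`. -/
def supTailCDF : StieltjesFunction ℝ where
  toFun x := if x < 0 then 0 else 1 - supTail x
  mono' x y h := by
    have := supTail_le_one y
    have := supTail_anti h
    dsimp only
    split_ifs <;> linarith
  right_continuous' x := by
    rcases lt_or_ge x 0 with hx | hx
    · refine ContinuousAt.continuousWithinAt (continuousAt_const.congr (f := fun _ => 0) ?_)
      filter_upwards [Iio_mem_nhds hx] with y hy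
      exact (if_pos (mem_Iio.1 hy)).symm
    · refine (continuousWithinAt_const.sub (continuousWithinAt_supTail x)).congr
        (fun y hy => if_neg (not_lt.2 (hx.trans hy))) (if_neg (not_lt.2 hx))

lemma tendsto_supTail : Tendsto supTail atTop (𝓝 0) := by
  refine squeeze_zero' (Eventually.of_forall fun x => (supTail_pos x).le)
    (g := fun x : ℝ => (x ^ 2)⁻¹) ?_ ?_
  · filter_upwards [eventually_gt_atTop 0] with x hx using supTail_le_inv_sq hx
  · exact tendsto_inv_atTop_zero.comp (tendsto_pow_atTop two_ne_zero)

lemma tendsto_supTailCDF_atTop : Tendsto supTailCDF atTop (𝓝 1) := by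
  have h : Tendsto (fun x => 1 - supTail x) atTop (𝓝 1) := by
    simpa using tendsto_supTail.const_sub 1
  refine h.congr' ?_
  filter_upwards [eventually_ge_atTop 0] with x hx
  exact (if_neg (not_lt.2 hx)).symm

lemma tendsto_supTailCDF_atBot : Tendsto supTailCDF atBot (𝓝 0) := by
  refine tendsto_const_nhds.congr' ?_
  filter_upwards [eventually_lt_atBot 0] with x hx
  exact (if_pos hx).symm

lemma supTailCDF_measure_Ioi {x : ℝ} (hx : 0 ≤ x) :
    supTailCDF.measure (Ioi x) = ENNReal.ofReal (supTail x) := by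
  rw [supTailCDF.measure_Ioi tendsto_supTailCDF_atTop]
  congr 1
  change 1 - (if x < 0 then 0 else 1 - supTail x) = _
  rw [if_neg (not_lt.2 hx)]
  ring

lemma tail_supTailCDF {x : ℝ} (hx : 0 ≤ x) : tail supTailCDF.measure x = supTail x := by
  rw [tail, supTailCDF_measure_Ioi hx, ENNReal.toReal_ofReal (supTail_pos x).le]

lemma isDistribution_supTailCDF : IsDistribution supTailCDF.measure := by
  refine ⟨⟨?_⟩, ?_, fun x => ?_⟩
  · rw [supTailCDF.measure_univ tendsto_supTailCDF_atBot tendsto_supTailCDF_atTop]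
    simp
  · rw [supTailCDF.measure_Iio tendsto_supTailCDF_atBot]
    have : Function.leftLim supTailCDF 0 = 0 := by
      refine leftLim_eq_of_tendsto (tendsto_const_nhds.congr' ?_)
      filter_upwards [self_mem_nhdsWithin] with x hx
      exact (if_pos hx).symm
    simp [this]
  · refine lt_of_lt_of_le ?_ (measure_mono (Ioi_subset_Ioi (le_max_left x 0)))
    rw [supTailCDF_measure_Ioi (le_max_right _ _)]
    exact ENNReal.ofReal_pos.2 (supTail_pos _)

lemma supTailCDF_finite_mean : ∫⁻ y, ENNReal.ofReal (1 + y) ∂supTailCDF.measure ≠ ⊤ := by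
  have hd := isDistribution_supTailCDF
  have := hd.1
  have hnn : 0 ≤ᵐ[supTailCDF.measure] fun y : ℝ => y := by
    rw [EventuallyLE, ae_iff]
    simpa [Iio_def] using hd.2.1
  have h1 : ∫⁻ y, ENNReal.ofReal (1 + y) ∂supTailCDF.measure
      ≤ ∫⁻ y, (1 + ENNReal.ofReal y) ∂supTailCDF.measure :=
    lintegral_mono fun y => by simpa using ENNReal.ofReal_add_le (p := 1) (q := y)
  refine ne_top_of_le_ne_top ?_ h1
  rw [lintegral_add_left measurable_const, lintegral_eq_lintegral_meas_lt _ hnn (by fun_prop)]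
  have h2 : ∫⁻ t in Ioi (0 : ℝ), supTailCDF.measure {a : ℝ | t < a}
      ≤ (∫⁻ _ in Ioc (0 : ℝ) 1, 1) + ∫⁻ t in Ioi (1 : ℝ), ENNReal.ofReal (t ^ (-2 : ℝ)) := by
    rw [← Ioc_union_Ioi_eq_Ioi zero_le_one]
    refine (lintegral_union_le _ _ _).trans (add_le_add ?_ ?_)
    · exact lintegral_mono fun t => prob_le_one
    · refine setLIntegral_mono' measurableSet_Ioi fun t ht => ?_
      have ht0 : (0 : ℝ) < t := lt_trans one_pos ht
      change supTailCDF.measure (Ioi t) ≤ _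
      rw [supTailCDF_measure_Ioi ht0.le, Real.rpow_neg ht0.le, Real.rpow_two]
      exact ENNReal.ofReal_le_ofReal (supTail_le_inv_sq ht0)
  have h3 : ∫⁻ t in Ioi (1 : ℝ), ENNReal.ofReal (t ^ (-2 : ℝ)) ≠ ⊤ :=
    (Integrable.lintegral_lt_top (integrableOn_Ioi_rpow_of_lt (by norm_num) one_pos)).ne
  simp only [lintegral_const, measure_univ, mul_one]
  refine ENNReal.add_ne_top.2 ⟨ENNReal.one_ne_top, ne_top_of_le_ne_top ?_ h2⟩
  simpa using h3

lemma supTailCDF_measure_Ioi_sub_le (x y : ℝ) (hy : 0 ≤ y) (hyx : y ≤ x / 2) :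
    supTailCDF.measure (Ioi (x - y)) ≤
      ENNReal.ofReal (4 * (1 + y)) * supTailCDF.measure (Ioi x) := by
  rw [supTailCDF_measure_Ioi (by linarith), supTailCDF_measure_Ioi (by linarith),
    ← ENNReal.ofReal_mul (by positivity)]
  exact ENNReal.ofReal_le_ofReal (supTail_sub_le hy hyx)

lemma memDK1_supTailCDF : MemDK1 supTailCDF.measure := by
  refine ⟨4, by norm_num, tendsto_atTop_mono' atTop ?_ tendsto_id⟩
  filter_upwards [eventually_ge_atTop 2] with x hx
  rw [tail_supTailCDF (by linarith)]
  have hx0 : 0 < x := by linarith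
  calc id x = x ^ (4 : ℝ) * (x ^ 3)⁻¹ := by
        rw [show (4 : ℝ) = (4 : ℕ) by norm_num, Real.rpow_natCast, id]
        field_simp
    _ ≤ x ^ (4 : ℝ) * supTail x := by gcongr; exact inv_cube_le_supTail hx

lemma frequently_tail_supTailCDF (M : ℝ) : ∃ t : ℝ, 0 ≤ t ∧ ∃ᶠ x in atTop,
    M * tail supTailCDF.measure x < tail supTailCDF.measure (x - t) := by
  refine ⟨|M|, abs_nonneg M, ?_⟩
  refine (tendsto_atTop_add_const_right atTop |M| tendsto_dropPoint).frequently
    (Eventually.frequently ?_)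
  filter_upwards [tendsto_dropPoint.eventually_ge_atTop (2 * (1 + |M|))] with n hn
  have ha := two_le_dropPoint n
  have hM := abs_nonneg M
  rw [add_sub_cancel_right, tail_supTailCDF (by linarith), tail_supTailCDF (by linarith)]
  refine lt_of_lt_of_le ?_ (supTail_drop hM hn)
  exact mul_lt_mul_of_pos_right (by linarith [le_abs_self M]) (supTail_pos _)

/-- there is a heavy-tailed `F ∈ 𝒥 \ (ℒ ∪ 𝒟)` with `F ∈ 𝒟𝒦₁` which is
not weakly tail equivalent to any subexponential distribution. -/
theorem exists_J_not_L_not_D_DK1_not_weakEquiv_subexp :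
    ∃ F : Measure ℝ, IsDistribution F ∧ HeavyTailed F ∧ MemJ F ∧
      ¬ MemL F ∧ ¬ MemD F ∧ MemDK1 F ∧
      ¬ ∃ G : Measure ℝ, IsDistribution G ∧ MemS G ∧ WeakTailEquiv F G := by
  have hd := isDistribution_supTailCDF
  exact ⟨supTailCDF.measure, hd, memDK1_supTailCDF.heavyTailed hd,
    memJ_of_finite_mean hd (by norm_num) supTailCDF_finite_mean supTailCDF_measure_Ioi_sub_le,
    not_memL_of_frequently hd frequently_tail_supTailCDF,
    not_memD_of_frequently hd frequently_tail_supTailCDF, memDK1_supTailCDF,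
    not_weakTailEquiv_memS hd frequently_tail_supTailCDF⟩
end
end

section
/- There exists a heavy-tailed distribution F on [0,∞) such that F ∈ 𝒥, F ∉ ℒ, F ∉ 𝒟, F ∉ 𝒟𝒦₁, and F is weakly tail equivalent to some subexponential distribution G ∈ 𝒮. -/
open MeasureTheory Filter Set Topology

noncomputable section

/-- The standard exponential law. -/
def stdExp : Measure ℝ :=
  (volume.restrict (Ioi 0)).withDensity fun u => ENNReal.ofReal (Real.exp (-u))

lemma setLIntegral_Ioi_stdExp {g : ℝ → ENNReal} (hg : Measurable g) {k : ℝ} (hk : 0 ≤ k) :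
    ∫⁻ u in Ioi k, g u ∂stdExp = ∫⁻ u in Ioi k, ENNReal.ofReal (Real.exp (-u)) * g u := by
  rw [stdExp, setLIntegral_withDensity_eq_setLIntegral_mul _ (by fun_prop) hg measurableSet_Ioi,
    Measure.restrict_restrict measurableSet_Ioi, Ioi_inter_Ioi, sup_of_le_left hk]
  rfl

lemma stdExp_Ioi {a : ℝ} (ha : 0 ≤ a) :
    stdExp (Ioi a) = ENNReal.ofReal (Real.exp (-a)) := by
  have h := setLIntegral_Ioi_stdExp (g := fun _ => 1) measurable_const ha
  simp only [lintegral_const, mul_one, one_mul, Measure.restrict_apply_univ] at h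
  rw [h, ← ofReal_integral_eq_lintegral_ofReal (integrableOn_exp_neg_Ioi a)
    (Eventually.of_forall fun _ => (Real.exp_pos _).le), integral_exp_neg_Ioi]

lemma stdExp_Iic_zero : stdExp (Iic 0) = 0 := by
  rw [stdExp, withDensity_apply _ measurableSet_Iic, Measure.restrict_restrict measurableSet_Iic,
    Iic_inter_Ioi, Ioc_self]
  simp

instance : NullSingletonClass stdExp := by
  unfold stdExp; infer_instance

instance : IsProbabilityMeasure stdExp := ⟨by
  rw [← Iic_union_Ioi (a := (0 : ℝ)),
    measure_union (Iic_disjoint_Ioi le_rfl) measurableSet_Ioi, stdExp_Iic_zero,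
    stdExp_Ioi le_rfl]
  simp⟩

lemma stdExp_Ioi_le (a : ℝ) : stdExp (Ioi a) ≤ ENNReal.ofReal (Real.exp (-a)) := by
  rcases le_total 0 a with ha | ha
  · exact (stdExp_Ioi ha).le
  · refine prob_le_one.trans ?_
    rw [← ENNReal.ofReal_one]
    exact ENNReal.ofReal_le_ofReal (Real.one_le_exp (by linarith))

lemma setLIntegral_exp_half_stdExp {k : ℝ} (hk : 0 ≤ k) (s : ℝ) :
    ∫⁻ u in Ioi k, ENNReal.ofReal (Real.exp (-(s - u / 2))) ∂stdExp =
      ENNReal.ofReal (2 * Real.exp (-k / 2) * Real.exp (-s)) := by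
  rw [setLIntegral_Ioi_stdExp (by fun_prop) hk]
  have h : ∀ u : ℝ, ENNReal.ofReal (Real.exp (-u)) * ENNReal.ofReal (Real.exp (-(s - u / 2))) =
      ENNReal.ofReal (Real.exp (-s) * Real.exp ((-1 / 2) * u)) := fun u => by
    rw [← ENNReal.ofReal_mul (Real.exp_pos _).le, ← Real.exp_add, ← Real.exp_add]
    congr 2; ring
  simp_rw [h]
  rw [← ofReal_integral_eq_lintegral_ofReal
    ((integrableOn_exp_mul_Ioi (by norm_num) k).const_mul _)
    (Eventually.of_forall fun _ => by positivity), integral_const_mul,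
    integral_exp_mul_Ioi (by norm_num)]
  congr 1
  rw [show (-1 / 2 : ℝ) * k = -k / 2 by ring]
  ring

lemma stdExp_prod_le {k : ℝ} (hk : 0 ≤ k) (s : ℝ) :
    (stdExp.prod stdExp) {p | k < p.1 ∧ s - p.1 / 2 < p.2} ≤
      ENNReal.ofReal (2 * Real.exp (-k / 2) * Real.exp (-s)) := by
  have hm : MeasurableSet {p : ℝ × ℝ | k < p.1 ∧ s - p.1 / 2 < p.2} := by measurability
  rw [Measure.prod_apply hm, ← setLIntegral_exp_half_stdExp hk,
    ← lintegral_indicator measurableSet_Ioi]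
  refine lintegral_mono fun u => ?_
  by_cases hu : u ∈ Ioi k
  · rw [indicator_of_mem hu]
    exact (measure_mono fun v hv => hv.2).trans (stdExp_Ioi_le _)
  · rw [indicator_of_notMem hu]
    have : Prod.mk u ⁻¹' {p : ℝ × ℝ | k < p.1 ∧ s - p.1 / 2 < p.2} = ∅ := by
      ext v
      simp only [mem_Ioi] at hu
      simp [hu]
    simp [this]

/-- Two squared exponential variables are jointly large with negligible probability. -/
lemma stdExp_prod_sq_le {k x : ℝ} (hk : 0 ≤ k) (hx0 : 0 ≤ x) :
    (stdExp.prod stdExp) {p | k < p.1 ∧ k < p.2 ∧ x < p.1 ^ 2 + p.2 ^ 2} ≤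
      ENNReal.ofReal (4 * Real.exp (-k / 2) * Real.exp (-√x)) := by
  have hm : MeasurableSet {p : ℝ × ℝ | k < p.1 ∧ √x - p.1 / 2 < p.2} := by measurability
  have key : ∀ u v : ℝ, 0 ≤ u → u ≤ v → x < u ^ 2 + v ^ 2 → √x - u / 2 < v := by
    intro u v hu huv hx
    have h : √x < v + u / 2 := by
      rw [Real.sqrt_lt hx0 (by linarith)]
      nlinarith [mul_le_mul_of_nonneg_left huv hu, sq_nonneg u]
    linarith
  have hsub : {p : ℝ × ℝ | k < p.1 ∧ k < p.2 ∧ x < p.1 ^ 2 + p.2 ^ 2} ⊆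
      {p | k < p.1 ∧ √x - p.1 / 2 < p.2} ∪
        Prod.swap ⁻¹' {p | k < p.1 ∧ √x - p.1 / 2 < p.2} := by
    rintro ⟨u, v⟩ ⟨hu, hv, hx⟩
    simp only at hu hv hx
    rcases le_total u v with h | h
    · exact Or.inl ⟨hu, key u v (by linarith) h hx⟩
    · exact Or.inr ⟨hv, key v u (by linarith) h (by linarith)⟩
  refine (measure_mono hsub).trans ((measure_union_le _ _).trans ?_)
  rw [← Measure.map_apply measurable_swap hm, Measure.prod_swap]
  refine (add_le_add (stdExp_prod_le hk _) (stdExp_prod_le hk _)).trans_eq ?_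
  rw [← ENNReal.ofReal_add (by positivity) (by positivity)]
  congr 1; ring

/-- Images of exponential variables under a map `f` with `f u ≤ u₊ ^ 2` are jointly large with
negligible probability. -/
lemma map_stdExp_prod_le {f : ℝ → ℝ} (hf : Measurable f) (hle : ∀ u, f u ≤ max u 0 ^ 2)
    {K x : ℝ} (hK : 0 ≤ K) (hx0 : 0 ≤ x) :
    ((stdExp.map f).prod (stdExp.map f)).real {p | K < p.1 ∧ K < p.2 ∧ x < p.1 + p.2} ≤
      4 * Real.exp (-√K / 2) * Real.exp (-√x) := by
  have hm : MeasurableSet {p : ℝ × ℝ | K < p.1 ∧ K < p.2 ∧ x < p.1 + p.2} := by measurability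
  have key : ∀ u, K < f u → √K < u ∧ f u ≤ u ^ 2 := by
    intro u hu
    have h1 : √K < max u 0 := by
      rw [Real.sqrt_lt hK (le_max_right _ _)]
      exact hu.trans_le (hle u)
    have h2 : √K < u := by
      rcases lt_max_iff.1 h1 with h | h
      · exact h
      · exact absurd h (Real.sqrt_nonneg K).not_gt
    refine ⟨h2, ?_⟩
    simpa [max_eq_left ((Real.sqrt_nonneg K).trans h2.le)] using hle u
  refine ENNReal.toReal_le_of_le_ofReal (by positivity) ?_
  rw [Measure.map_prod_map _ _ hf hf, Measure.map_apply (hf.prodMap hf) hm]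
  refine (measure_mono ?_).trans (stdExp_prod_sq_le (Real.sqrt_nonneg K) hx0)
  rintro ⟨u, v⟩ ⟨hu, hv, hx⟩
  simp only [Prod.map_fst, Prod.map_snd] at hu hv hx
  have := key u hu
  have := key v hv
  exact ⟨by simp_all, by simp_all, by simp only; linarith⟩

section Generic

variable {F : Measure ℝ}

lemma prod_real_prod_Ici_zero [IsProbabilityMeasure F] (h0 : F (Iio 0) = 0) (x : ℝ) :
    (F.prod F).real (Ioi x ×ˢ Ici 0) = tail F x ∧
      (F.prod F).real (Ici 0 ×ˢ Ioi x) = tail F x := by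
  have h : F.real (Ici 0) = 1 := by
    rw [← compl_Iio, probReal_compl_eq_one_sub measurableSet_Iio, measureReal_def, h0]
    simp
  rw [measureReal_prod_prod, measureReal_prod_prod, h]
  simp [tail, measureReal_def]

lemma two_mul_tail_sub_le [IsProbabilityMeasure F] (h0 : F (Iio 0) = 0) {x : ℝ} (hx : 0 ≤ x) :
    2 * tail F x - tail F x ^ 2 ≤ (F.prod F).real {p | x < p.1 + p.2} := by
  obtain ⟨h1, h2⟩ := prod_real_prod_Ici_zero h0 x
  have hu := measureReal_union_add_inter (μ := F.prod F) (s := Ioi x ×ˢ Ici (0 : ℝ))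
    (t := Ici (0 : ℝ) ×ˢ Ioi x) (measurableSet_Ici.prod measurableSet_Ioi)
  have hsub : Ioi x ⊆ Ici 0 := fun y (hy : x < y) => (hx.trans_lt hy).le
  have hi : (Ioi x ×ˢ Ici (0 : ℝ)) ∩ (Ici (0 : ℝ) ×ˢ Ioi x) = Ioi x ×ˢ Ioi x := by
    rw [prod_inter_prod, inter_eq_left.2 hsub, inter_eq_right.2 hsub]
  rw [hi, measureReal_prod_prod, h1, h2] at hu
  have hs : (F.prod F).real ((Ioi x ×ˢ Ici (0 : ℝ)) ∪ (Ici (0 : ℝ) ×ˢ Ioi x)) ≤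
      (F.prod F).real {p | x < p.1 + p.2} := by
    refine measureReal_mono ?_
    rintro ⟨u, v⟩ (⟨h, h'⟩ | ⟨h, h'⟩) <;>
    · simp only [mem_Ioi, mem_Ici, mem_ofPred_eq] at *
      linarith
  change _ + tail F x * tail F x = _ at hu
  linarith

lemma tail_le_prod_real [IsProbabilityMeasure F] (h0 : F (Iio 0) = 0) (x : ℝ) :
    tail F x ≤ (F.prod F).real {p | x < p.1 + p.2} := by
  rw [← (prod_real_prod_Ici_zero h0 x).1]
  refine measureReal_mono ?_
  rintro ⟨u, v⟩ ⟨h, h'⟩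
  simp only [mem_Ioi, mem_Ici, mem_ofPred_eq] at *
  linarith

lemma prod_real_le_add [IsProbabilityMeasure F] (x K : ℝ) :
    (F.prod F).real {p | x < p.1 + p.2} ≤ 2 * tail F (x - K) +
      (F.prod F).real {p | K < p.1 ∧ K < p.2 ∧ x < p.1 + p.2} := by
  have hs : {p : ℝ × ℝ | x < p.1 + p.2} ⊆ (univ ×ˢ Ioi (x - K) ∪ Ioi (x - K) ×ˢ univ) ∪
      {p | K < p.1 ∧ K < p.2 ∧ x < p.1 + p.2} := by
    rintro ⟨u, v⟩ h
    simp only [mem_ofPred_eq, mem_union, mem_prod, mem_univ, mem_Ioi, true_and, and_true] at *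
    by_cases hu : K < u
    · by_cases hv : K < v
      · exact Or.inr ⟨hu, hv, h⟩
      · exact Or.inl (Or.inr (by linarith))
    · exact Or.inl (Or.inl (by linarith))
  have h1 := (measureReal_mono (μ := F.prod F) hs).trans (measureReal_union_le _ _)
  have h2 := measureReal_union_le (μ := F.prod F) (univ ×ˢ Ioi (x - K)) (Ioi (x - K) ×ˢ univ)
  rw [measureReal_prod_prod, measureReal_prod_prod] at h2
  simp only [probReal_univ, one_mul, mul_one] at h2
  change _ ≤ tail F (x - K) + tail F (x - K) at h2
  linarith

lemma heavyTailed_of_le_tail [IsFiniteMeasure F]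
    (hl : ∀ x, 0 ≤ x → Real.exp (-√x - 1) ≤ tail F x) : HeavyTailed F := by
  intro a ha
  have hlim : Tendsto (fun r : ℝ => ENNReal.ofReal (Real.exp (a * r ^ 2 + (-r - 1))))
      atTop (𝓝 ⊤) := by
    refine ENNReal.tendsto_ofReal_atTop.comp (Real.tendsto_exp_atTop.comp ?_)
    have : Tendsto (fun r : ℝ => r * (a * r - 1) + -1) atTop atTop :=
      tendsto_atTop_add_const_right _ _ (tendsto_id.atTop_mul_atTop₀
        (tendsto_atTop_add_const_right _ (-1) (tendsto_id.const_mul_atTop ha)))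
    refine this.congr fun r => by ring
  refine top_le_iff.1 (le_of_tendsto hlim ?_)
  filter_upwards [eventually_ge_atTop 0] with r hr
  have h1 := hl (r ^ 2) (sq_nonneg r)
  rw [Real.sqrt_sq hr] at h1
  calc ENNReal.ofReal (Real.exp (a * r ^ 2 + (-r - 1)))
      = ENNReal.ofReal (Real.exp (a * r ^ 2)) * ENNReal.ofReal (Real.exp (-r - 1)) := by
        rw [Real.exp_add, ENNReal.ofReal_mul (Real.exp_pos _).le]
    _ ≤ ENNReal.ofReal (Real.exp (a * r ^ 2)) * F (Ioi (r ^ 2)) := by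
        gcongr
        exact ENNReal.ofReal_le_of_le_toReal h1
    _ ≤ ENNReal.ofReal (Real.exp (a * r ^ 2)) *
          F {y | ENNReal.ofReal (Real.exp (a * r ^ 2)) ≤ ENNReal.ofReal (Real.exp (a * y))} := by
        gcongr
        intro y (hy : r ^ 2 < y)
        exact ENNReal.ofReal_le_ofReal (Real.exp_le_exp.2 (by gcongr))
    _ ≤ _ := mul_meas_ge_le_lintegral (by fun_prop) _

lemma not_memD_of_tail_bounds [IsFiniteMeasure F]
    (hl : ∀ x, 0 ≤ x → Real.exp (-√x - 1) ≤ tail F x)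
    (hu : ∀ x, 0 ≤ x → tail F x ≤ Real.exp (-√x)) : ¬ MemD F := by
  intro h
  obtain ⟨C, hC, hC'⟩ := exists_between h
  have hev := eventually_lt_of_limsup_lt hC
  have hlim : Tendsto (fun r : ℝ => Real.exp (r - 1)) atTop atTop :=
    Real.tendsto_exp_atTop.comp (tendsto_atTop_add_const_right _ _ tendsto_id)
  have hq : Tendsto (fun r : ℝ => 16 * r ^ 2) atTop atTop :=
    (tendsto_pow_atTop two_ne_zero).const_mul_atTop (by norm_num)
  obtain ⟨r, ⟨h1, h2⟩, h3⟩ := ((hq.eventually hev).and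
    (hlim.eventually_gt_atTop C.toReal)).and (eventually_ge_atTop 0) |>.exists
  have h4 := ENNReal.toReal_mono hC'.ne h1.le
  rw [ENNReal.toReal_div] at h4
  change tail F _ / tail F _ ≤ _ at h4
  have h5 := hl (16 * r ^ 2 / 2) (by positivity)
  have h6 := hu (16 * r ^ 2) (by positivity)
  have h7 := hl (16 * r ^ 2) (by positivity)
  have e1 : √(16 * r ^ 2) = 4 * r := by
    rw [show 16 * r ^ 2 = (4 * r) ^ 2 by ring, Real.sqrt_sq (by positivity)]
  have e2 : √(16 * r ^ 2 / 2) ≤ 3 * r := by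
    rw [Real.sqrt_le_left (by positivity)]
    nlinarith [sq_nonneg r]
  rw [e1] at h6 h7
  have h8 : Real.exp (r - 1) ≤ tail F (16 * r ^ 2 / 2) / tail F (16 * r ^ 2) := by
    rw [le_div_iff₀ ((Real.exp_pos _).trans_le h7)]
    calc Real.exp (r - 1) * tail F (16 * r ^ 2) ≤ Real.exp (r - 1) * Real.exp (-(4 * r)) := by
          gcongr
      _ = Real.exp (-(3 * r) - 1) := by rw [← Real.exp_add]; congr 1; ring
      _ ≤ Real.exp (-√(16 * r ^ 2 / 2) - 1) := by gcongr
      _ ≤ _ := h5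
  linarith

lemma not_memDK1_of_tail_le (hu : ∀ x, 0 ≤ x → tail F x ≤ Real.exp (-√x)) : ¬ MemDK1 F := by
  rintro ⟨δ, -, h⟩
  have hlim := (tendsto_rpow_mul_exp_neg_mul_atTop_nhds_zero (2 * δ) 1 one_pos).comp
    Real.tendsto_sqrt_atTop
  obtain ⟨x, ⟨h1, h2⟩, h3⟩ := ((h.eventually_gt_atTop 1).and
    (hlim.eventually_lt_const one_pos)).and (eventually_ge_atTop 0) |>.exists
  simp only [Function.comp_apply] at h2
  rw [Real.rpow_mul (Real.sqrt_nonneg x), Real.rpow_two, Real.sq_sqrt h3, neg_one_mul] at h2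
  have := mul_le_mul_of_nonneg_left (hu x h3) (Real.rpow_nonneg h3 δ)
  linarith

lemma memJ_of_bounds [IsProbabilityMeasure F] (h0 : F (Iio 0) = 0)
    (hl : ∀ x, 0 ≤ x → Real.exp (-√x - 1) ≤ tail F x)
    (hp : ∀ K, 0 ≤ K → ∀ x, 0 ≤ x → (F.prod F).real {p | K < p.1 ∧ K < p.2 ∧ x < p.1 + p.2} ≤
      4 * Real.exp (-√K / 2) * Real.exp (-√x)) : MemJ F := by
  have hone : ∀ K x : ℝ, ((F.prod F) {p : ℝ × ℝ | min p.1 p.2 ≤ K ∧ x < p.1 + p.2}).toReal /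
      ((F.prod F) {p : ℝ × ℝ | x < p.1 + p.2}).toReal ≤ 1 := fun K x =>
    div_le_one_of_le₀ (measureReal_mono fun p hp => hp.2) measureReal_nonneg
  have hlow : ∀ K, 0 ≤ K → ∀ x, 0 ≤ x → 1 - 4 * Real.exp 1 * Real.exp (-√K / 2) ≤
      ((F.prod F) {p : ℝ × ℝ | min p.1 p.2 ≤ K ∧ x < p.1 + p.2}).toReal /
      ((F.prod F) {p : ℝ × ℝ | x < p.1 + p.2}).toReal := by
    intro K hK x hx
    have h1 := (hl x hx).trans (tail_le_prod_real h0 x)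
    have h2 : (F.prod F).real {p | x < p.1 + p.2} ≤
        (F.prod F).real {p | min p.1 p.2 ≤ K ∧ x < p.1 + p.2} +
        (F.prod F).real {p | K < p.1 ∧ K < p.2 ∧ x < p.1 + p.2} := by
      refine (measureReal_mono ?_).trans (measureReal_union_le _ _)
      intro p (hp : x < _)
      rcases le_or_gt (min p.1 p.2) K with h | h
      · exact Or.inl ⟨h, hp⟩
      · exact Or.inr ⟨(lt_min_iff.1 h).1, (lt_min_iff.1 h).2, hp⟩
    have h3 := hp K hK x hx
    change _ ≤ (F.prod F).real _ / (F.prod F).real _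
    rw [le_div_iff₀ ((Real.exp_pos _).trans_le h1)]
    have h4 : 4 * Real.exp (-√K / 2) * Real.exp (-√x) =
        4 * Real.exp 1 * Real.exp (-√K / 2) * Real.exp (-√x - 1) := by
      have : Real.exp (-√x) = Real.exp 1 * Real.exp (-√x - 1) := by
        rw [← Real.exp_add]; congr 1; ring
      rw [this]; ring
    have h5 := mul_le_mul_of_nonneg_left h1
      (show 0 ≤ 4 * Real.exp 1 * Real.exp (-√K / 2) by positivity)
    linarith
  have hlim : Tendsto (fun K : ℝ => 1 - 4 * Real.exp 1 * Real.exp (-√K / 2)) atTop (𝓝 1) := by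
    have : Tendsto (fun K : ℝ => Real.exp (-√K / 2)) atTop (𝓝 0) :=
      Real.tendsto_exp_atBot.comp
        ((tendsto_neg_atTop_atBot.comp Real.tendsto_sqrt_atTop).atBot_div_const two_pos)
    simpa using (this.const_mul (4 * Real.exp 1)).const_sub 1
  refine tendsto_of_tendsto_of_tendsto_of_le_of_le' hlim tendsto_const_nhds ?_ ?_
  · filter_upwards [eventually_ge_atTop 0] with K hK
    refine le_liminf_of_le ?_ ?_
    · exact IsBoundedUnder.isCoboundedUnder_ge ⟨1, eventually_map.2 (Eventually.of_forall (hone K))⟩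
    · filter_upwards [eventually_ge_atTop 0] with x hx using hlow K hK x hx
  · filter_upwards [eventually_ge_atTop 0] with K hK
    refine liminf_le_of_frequently_le (Eventually.of_forall (hone K)).frequently ?_
    exact ⟨0, eventually_map.2 (Eventually.of_forall fun x =>
      div_nonneg ENNReal.toReal_nonneg ENNReal.toReal_nonneg)⟩

lemma memS_of_bounds [IsProbabilityMeasure F] (h0 : F (Iio 0) = 0)
    (ht : ∀ x, 0 ≤ x → tail F x = Real.exp (-√x))
    (hp : ∀ K, 0 ≤ K → ∀ x, 0 ≤ x → (F.prod F).real {p | K < p.1 ∧ K < p.2 ∧ x < p.1 + p.2} ≤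
      4 * Real.exp (-√K / 2) * Real.exp (-√x)) : MemS F := by
  have hc : ∀ x, (conv2 F (Ioi x)).toReal = (F.prod F).real {p | x < p.1 + p.2} := fun x => by
    rw [conv2, Measure.map_apply (by fun_prop) measurableSet_Ioi]
    rfl
  have hexp : Tendsto (fun x : ℝ => Real.exp (-√x)) atTop (𝓝 0) :=
    Real.tendsto_exp_atBot.comp (tendsto_neg_atTop_atBot.comp Real.tendsto_sqrt_atTop)
  have hlo : Tendsto (fun x : ℝ => 2 - Real.exp (-√x)) atTop (𝓝 2) := by
    simpa using hexp.const_sub 2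
  have hr : Tendsto (fun x : ℝ => √√x) atTop atTop :=
    Real.tendsto_sqrt_atTop.comp Real.tendsto_sqrt_atTop
  have hup : Tendsto (fun x : ℝ => 2 * Real.exp (√√x)⁻¹ + 4 * Real.exp (-√√√x / 2))
      atTop (𝓝 2) := by
    have h1 : Tendsto (fun x : ℝ => Real.exp (√√x)⁻¹) atTop (𝓝 1) := by
      simpa [Function.comp_def] using (Real.continuous_exp.tendsto 0).comp (tendsto_inv_atTop_zero.comp hr)
    have h2 : Tendsto (fun x : ℝ => Real.exp (-√√√x / 2)) atTop (𝓝 0) :=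
      Real.tendsto_exp_atBot.comp ((tendsto_neg_atTop_atBot.comp
        (Real.tendsto_sqrt_atTop.comp hr)).atBot_div_const two_pos)
    simpa using (h1.const_mul 2).add (h2.const_mul 4)
  refine tendsto_of_tendsto_of_tendsto_of_le_of_le' hlo hup ?_ ?_
  · filter_upwards [eventually_ge_atTop 0] with x hx
    have := two_mul_tail_sub_le h0 hx
    rw [hc, ht x hx, le_div_iff₀ (Real.exp_pos _)]
    rw [ht x hx] at this
    linarith
  · filter_upwards [eventually_ge_atTop 0, hr.eventually_ge_atTop 1] with x hx hr1
    have h1 := prod_real_le_add (F := F) x √√x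
    have h2 := hp √√x (Real.sqrt_nonneg _) x hx
    have hsq : √√x ^ 2 = √x := Real.sq_sqrt (Real.sqrt_nonneg x)
    have hx4 : √√x ^ 4 = x := by
      rw [show √√x ^ 4 = (√√x ^ 2) ^ 2 by ring, hsq, Real.sq_sqrt hx]
    have hxr : 0 ≤ x - √√x := by
      have := le_self_pow₀ hr1 (show 4 ≠ 0 by norm_num)
      linarith
    have hs : √x - (√√x)⁻¹ ≤ √(x - √√x) := by
      refine Real.le_sqrt_of_sq_le ?_
      have hi : (√√x)⁻¹ ≤ 1 := inv_le_one_of_one_le₀ hr1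
      have hi0 : 0 ≤ (√√x)⁻¹ := by positivity
      have hm : √√x * (√√x)⁻¹ = 1 := mul_inv_cancel₀ (by positivity)
      generalize hg : √√x = r at *
      rw [← hsq, ← hx4, show (r ^ 2 - r⁻¹) ^ 2 =
        r ^ 4 - 2 * r * (r * r⁻¹) + r⁻¹ ^ 2 by ring, hm]
      nlinarith
    rw [hc, ht x hx, div_le_iff₀ (Real.exp_pos _)]
    rw [ht _ hxr] at h1
    have h3 : Real.exp (-√(x - √√x)) ≤ Real.exp (√√x)⁻¹ * Real.exp (-√x) := by
      rw [← Real.exp_add]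
      exact Real.exp_le_exp.2 (by linarith)
    linarith

end Generic

lemma isDistribution_map_stdExp {f : ℝ → ℝ} (hf : Measurable f) (h0 : ∀ u, 0 ≤ f u)
    (hl : ∀ x, 0 ≤ x → 0 < tail (stdExp.map f) x) : IsDistribution (stdExp.map f) := by
  refine ⟨Measure.isProbabilityMeasure_map hf.aemeasurable, ?_, fun x => ?_⟩
  · rw [Measure.map_apply hf measurableSet_Iio]
    convert measure_empty (μ := stdExp)
    ext u
    simpa using h0 u
  · exact (ENNReal.toReal_pos_iff.1 (hl _ (le_max_right x 0))).1.trans_le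
      (measure_mono (Ioi_subset_Ioi (le_max_left x 0)))

lemma map_sq_stdExp_Ioi {x : ℝ} (hx : 0 ≤ x) :
    (stdExp.map fun u => max u 0 ^ 2) (Ioi x) = ENNReal.ofReal (Real.exp (-√x)) := by
  rw [Measure.map_apply (by fun_prop) measurableSet_Ioi, ← stdExp_Ioi (Real.sqrt_nonneg x)]
  congr 1
  ext u
  have h : ¬ √x < 0 := (Real.sqrt_nonneg x).not_gt
  rw [mem_preimage, mem_Ioi, ← Real.sqrt_lt hx (le_max_right _ _), mem_Ioi, lt_max_iff]
  simp [h]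

lemma map_floor_sq_stdExp_Ioi {x : ℝ} (hx : 0 ≤ x) :
    (stdExp.map fun u => (⌊u⌋₊ : ℝ) ^ 2) (Ioi x) =
      ENNReal.ofReal (Real.exp (-(⌊√x⌋₊ + 1))) := by
  have hm : Measurable fun u : ℝ => (⌊u⌋₊ : ℝ) ^ 2 := by fun_prop
  rw [Measure.map_apply hm measurableSet_Ioi]
  have h : (fun u : ℝ => (⌊u⌋₊ : ℝ) ^ 2) ⁻¹' Ioi x = Ici ((⌊√x⌋₊ + 1 : ℝ)) := by
    ext u
    rw [mem_preimage, mem_Ioi, ← Real.sqrt_lt hx (Nat.cast_nonneg _), mem_Ici,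
      ← Nat.floor_lt (Real.sqrt_nonneg x), ← Nat.succ_le_iff, Nat.le_floor_iff' (by simp)]
    simp
  rw [h, ← Ioi_ae_eq_Ici.measure_eq, stdExp_Ioi (by positivity)]

/-- there is a heavy-tailed `F ∈ 𝒥 \ (ℒ ∪ 𝒟)` with `F ∉ 𝒟𝒦₁` which is
weakly tail equivalent to a subexponential distribution. -/
theorem exists_J_not_L_not_D_not_DK1_weakEquiv_subexp :
    ∃ F : Measure ℝ, IsDistribution F ∧ HeavyTailed F ∧ MemJ F ∧
      ¬ MemL F ∧ ¬ MemD F ∧ ¬ MemDK1 F ∧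
      ∃ G : Measure ℝ, IsDistribution G ∧ MemS G ∧ WeakTailEquiv F G := by
  have hfm : Measurable fun u : ℝ => (⌊u⌋₊ : ℝ) ^ 2 := by fun_prop
  have hgm : Measurable fun u : ℝ => max u 0 ^ 2 := by fun_prop
  have hfg : ∀ u : ℝ, (⌊u⌋₊ : ℝ) ^ 2 ≤ max u 0 ^ 2 := fun u => by
    gcongr
    rcases le_total 0 u with h | h
    · exact (Nat.floor_le h).trans (le_max_left _ _)
    · simp [Nat.floor_of_nonpos h]
  have htF : ∀ x, 0 ≤ x → tail (stdExp.map fun u => (⌊u⌋₊ : ℝ) ^ 2) x =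
      Real.exp (-(⌊√x⌋₊ + 1)) := fun x hx => by
    rw [tail, map_floor_sq_stdExp_Ioi hx, ENNReal.toReal_ofReal (Real.exp_pos _).le]
  have htG : ∀ x, 0 ≤ x → tail (stdExp.map fun u => max u 0 ^ 2) x = Real.exp (-√x) :=
    fun x hx => by
      rw [tail, map_sq_stdExp_Ioi hx, ENNReal.toReal_ofReal (Real.exp_pos _).le]
  have hl : ∀ x, 0 ≤ x →
      Real.exp (-√x - 1) ≤ tail (stdExp.map fun u => (⌊u⌋₊ : ℝ) ^ 2) x := fun x hx => by
    rw [htF x hx]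
    exact Real.exp_le_exp.2 (by linarith [Nat.floor_le (Real.sqrt_nonneg x)])
  have hu : ∀ x, 0 ≤ x →
      tail (stdExp.map fun u => (⌊u⌋₊ : ℝ) ^ 2) x ≤ Real.exp (-√x) := fun x hx => by
    rw [htF x hx]
    exact Real.exp_le_exp.2 (by linarith [Nat.lt_floor_add_one √x])
  have hF := isDistribution_map_stdExp hfm (fun u => sq_nonneg _)
    fun x hx => (Real.exp_pos _).trans_le (hl x hx)
  have hG := isDistribution_map_stdExp hgm (fun u => sq_nonneg _)
    fun x hx => (Real.exp_pos _).trans_eq (htG x hx).symm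
  have := hF.1
  have := hG.1
  refine ⟨_, hF, heavyTailed_of_le_tail hl,
    memJ_of_bounds hF.2.1 hl fun K hK x hx => map_stdExp_prod_le hfm hfg hK hx, ?_,
    not_memD_of_tail_bounds hl hu, not_memDK1_of_tail_le hu, _, hG,
    memS_of_bounds hG.2.1 htG fun K hK x hx => map_stdExp_prod_le hgm (fun u => le_rfl) hK hx,
    ?_, ?_⟩
  · intro h
    have hsq : Tendsto (fun n : ℕ => ((n : ℝ) + 1) ^ 2) atTop atTop :=
      (tendsto_pow_atTop two_ne_zero).comp
        (tendsto_atTop_add_const_right _ _ tendsto_natCast_atTop_atTop)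
    have h1 := (h 1 one_pos).comp hsq
    have h2 : ∀ n : ℕ, tail (stdExp.map fun u => (⌊u⌋₊ : ℝ) ^ 2) (((n : ℝ) + 1) ^ 2 - 1) /
        tail (stdExp.map fun u => (⌊u⌋₊ : ℝ) ^ 2) (((n : ℝ) + 1) ^ 2) = Real.exp 1 := by
      intro n
      have hn : (0 : ℝ) ≤ n := n.cast_nonneg
      have hx : (0 : ℝ) ≤ ((n : ℝ) + 1) ^ 2 - 1 := by nlinarith
      have f1 : ⌊√(((n : ℝ) + 1) ^ 2 - 1)⌋₊ = n := by
        rw [Nat.floor_eq_iff (Real.sqrt_nonneg _)]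
        constructor
        · exact Real.le_sqrt_of_sq_le (by nlinarith)
        · rw [Real.sqrt_lt hx (by positivity)]
          linarith
      have f2 : ⌊√(((n : ℝ) + 1) ^ 2)⌋₊ = n + 1 := by
        rw [Real.sqrt_sq (by positivity)]
        exact_mod_cast Nat.floor_natCast (n + 1)
      rw [htF _ hx, htF _ (by positivity), f1, f2, ← Real.exp_sub]
      congr 1
      push_cast
      ring
    have h3 := tendsto_nhds_unique h1 (tendsto_const_nhds.congr fun n => (h2 n).symm)
    have := Real.add_one_lt_exp one_ne_zero
    linarith
  · refine (ENNReal.ofReal_pos.2 (Real.exp_pos (-1))).trans_le (le_liminf_of_le ?_ ?_)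
    · isBoundedDefault
    filter_upwards [eventually_ge_atTop 0] with x hx
    rw [map_floor_sq_stdExp_Ioi hx, map_sq_stdExp_Ioi hx,
      ← ENNReal.ofReal_div_of_pos (Real.exp_pos _), ← Real.exp_sub]
    exact ENNReal.ofReal_le_ofReal
      (Real.exp_le_exp.2 (by linarith [Nat.floor_le (Real.sqrt_nonneg x)]))
  · refine (limsup_le_of_le ?_ ?_).trans_lt ENNReal.one_lt_top
    · isBoundedDefault
    filter_upwards [eventually_ge_atTop 0] with x hx
    rw [map_floor_sq_stdExp_Ioi hx, map_sq_stdExp_Ioi hx]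
    refine ENNReal.div_le_of_le_mul ?_
    rw [one_mul]
    exact ENNReal.ofReal_le_ofReal
      (Real.exp_le_exp.2 (by linarith [Nat.lt_floor_add_one √x]))
end
end
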